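/- Murnaghan–Nakayama rule for K-k-Schur functions: with the data below, for every 1 ≤ r ≤ k and every w ∈ S̃⁰_{k+1}, one has p^R_r g_w = Σ_{w' ∈ S̃⁰_{k+1}} (−1)^{r − l(w') + l(w)} ( Σ_{i=0}^{r−1} (−1)^i |V^{r,w'}_{i,wc}| + Σ_{i=1}^{r−1} (−1)^i (r−i) |U^{r,w'}_{i−1,wc}| + Σ_{i=1}^{r−2} (−1)^i |U^{r,w'}_{i−1,w̄c,left}| ) g_{w'}, where X^{r,w'}_• = {u ∈ X^r_• : u * w = w'} with * the star action. -/

import Mathlib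

open scoped BigOperators Classical

noncomputable section

namespace MN

/-! ## Residues, words, canonical cyclic intervals -/

/-- The residues `ℤ/(k+1)ℤ`. -/
abbrev Idx (k : ℕ) := ZMod (k + 1)

/-- A word in the generators, recorded by its list of indices. -/
abbrev Word (k : ℕ) := List (Idx k)

/-- The support of a word. -/
def supp (k : ℕ) (u : Word k) : Finset (Idx k) := u.toFinset

/-- The smallest `a ∈ {0,…,k}` (as a natural number) with `(a : ℤ/(k+1)) ∉ S`. -/
def gapNat (k : ℕ) (S : Finset (Idx k)) : ℕ :=
  if h : ∃ m : ℕ, m ≤ k ∧ (m : Idx k) ∉ S then Nat.find h else 0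

/-- The gap element `a` of a proper subset `S`. -/
def gap (k : ℕ) (S : Finset (Idx k)) : Idx k := (gapNat k S : Idx k)

/-- Position of a residue `i` in the canonical cyclic interval
`I_S : a+1 < a+2 < ⋯ < k < 0 < ⋯ < a−1` (the gap `a` itself gets the junk position `k`). -/
def pos (k : ℕ) (S : Finset (Idx k)) (i : Idx k) : ℕ := (i - gap k S - 1).val

/-- The list of positions of the letters of `u` in the canonical cyclic interval of its support. -/
def posList (k : ℕ) (u : Word k) : List ℕ := u.map (pos k (supp k u))

/-- A weak hook word of hook type V:
`i₁ > ⋯ > i_j < i_{j+1} < ⋯ < i_m` with respect to `I_{supp u}`. -/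
def IsHookV (k : ℕ) (u : Word k) : Prop :=
  supp k u ≠ Finset.univ ∧
    ∃ (ds as : List ℕ) (v : ℕ),
      posList k u = ds ++ v :: as ∧
        List.Chain' (· > ·) (ds ++ [v]) ∧ List.Chain' (· < ·) (v :: as)

/-- A weak hook word of hook type U:
`i₁ > ⋯ > i_j = i_{j+1} < ⋯ < i_m` with respect to `I_{supp u}`. -/
def IsHookU (k : ℕ) (u : Word k) : Prop :=
  supp k u ≠ Finset.univ ∧
    ∃ (ds as : List ℕ) (v : ℕ),
      posList k u = ds ++ v :: v :: as ∧
        List.Chain' (· > ·) (ds ++ [v]) ∧ List.Chain' (· < ·) (v :: as)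

/-- A weak hook word. -/
def IsWeakHook (k : ℕ) (u : Word k) : Prop := IsHookV k u ∨ IsHookU k u

/-- The number of ascents `i_t < i_{t+1}` of a word. -/
def asc (k : ℕ) (u : Word k) : ℕ :=
  ((posList k u).zip (posList k u).tail).countP fun p => decide (p.1 < p.2)

/-- The candidates `c` in the definition of `u_min`: letters `c` of `u` for which there is a
letter `a` of `u` with `a < c` in `I_{supp u}`, `a + 1 ≠ c`, and no letter `b` of `u` satisfies
`a < b < c`. -/
def uminCands (k : ℕ) (u : Word k) : Finset (Idx k) :=
  (supp k u).filter fun c =>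
    ∃ a ∈ supp k u,
      pos k (supp k u) a < pos k (supp k u) c ∧ a + 1 ≠ c ∧
        ∀ b ∈ supp k u,
          ¬(pos k (supp k u) a < pos k (supp k u) b ∧
            pos k (supp k u) b < pos k (supp k u) c)

/-- The letter `u_min` of `u` (junk value `0` if there is no candidate). -/
def umin (k : ℕ) (u : Word k) : Idx k :=
  if h : (uminCands k u).Nonempty then
    ((uminCands k u).exists_min_image (pos k (supp k u)) h).choose
  else 0

/-- The number of occurrences of `u_min` in `u` (`0` if there is no candidate). -/
def uminCount (k : ℕ) (u : Word k) : ℕ :=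
  if (uminCands k u).Nonempty then u.count (umin k u) else 0

/-- A set of residues is `k`-connected if it is a proper subset of `{0,…,k}` which is an
interval with respect to its canonical cyclic interval order. -/
def IsKConnectedSet (k : ℕ) (S : Finset (Idx k)) : Prop :=
  S ≠ Finset.univ ∧
    ∀ i ∈ S, ∀ j ∈ S, ∀ m : Idx k,
      pos k S i ≤ pos k S m → pos k S m ≤ pos k S j → m ∈ S

/-- A word is `k`-connected if its support is. -/
def IsKConnected (k : ℕ) (u : Word k) : Prop := IsKConnectedSet k (supp k u)

/-- A word is `k`-weak connected if `u_min` occurs `0` or `2` times in it. -/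
def IsWeakConnected (k : ℕ) (u : Word k) : Prop :=
  uminCount k u = 0 ∨ uminCount k u = 2

/-- The letter `c` lies on the left side (the maximal strictly decreasing initial segment) of
the hook form of `u`: equivalently, it occurs in some strictly decreasing initial segment. -/
def OnLeftSide (k : ℕ) (u : Word k) (c : Idx k) : Prop :=
  ∃ p q : Word k, u = p ++ q ∧
    List.Chain' (fun a b => pos k (supp k u) b < pos k (supp k u) a) p ∧ c ∈ p

/-- The letter `c` lies on the right side (the maximal strictly increasing final segment) of
the hook form of `u`. -/
def OnRightSide (k : ℕ) (u : Word k) (c : Idx k) : Prop :=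
  ∃ p q : Word k, u = p ++ q ∧
    List.Chain' (fun a b => pos k (supp k u) a < pos k (supp k u) b) q ∧ c ∈ q

/-! ## The sets `X^r_i` and their refinements (indexed by `i : ℤ`, empty for `i < 0`) -/

/-- `V^r_i`: weak hook words of hook type V, weak length `r`, `asc = i`. -/
def VSet (k r : ℕ) (i : ℤ) : Set (Word k) :=
  {u | IsHookV k u ∧ u.length = r ∧ (asc k u : ℤ) = i}

/-- `U^r_i`. -/
def USet (k r : ℕ) (i : ℤ) : Set (Word k) :=
  {u | IsHookU k u ∧ u.length = r ∧ (asc k u : ℤ) = i}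

/-- `V^r_{i,wc}`: the `k`-weak connected members of `V^r_i`. -/
def VSetWC (k r : ℕ) (i : ℤ) : Set (Word k) := {u ∈ VSet k r i | IsWeakConnected k u}

/-- `U^r_{i,wc}`. -/
def USetWC (k r : ℕ) (i : ℤ) : Set (Word k) := {u ∈ USet k r i | IsWeakConnected k u}

/-- `V^r_{i,c}`: the `k`-connected members of `V^r_i`. -/
def VSetC (k r : ℕ) (i : ℤ) : Set (Word k) := {u ∈ VSet k r i | IsKConnected k u}

/-- `V^r_{i,w̄c,left}`. -/
def VSetNWCL (k r : ℕ) (i : ℤ) : Set (Word k) :=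
  {u ∈ VSet k r i | ¬IsWeakConnected k u ∧ OnLeftSide k u (umin k u)}

/-- `V^r_{i,w̄c,right}`. -/
def VSetNWCR (k r : ℕ) (i : ℤ) : Set (Word k) :=
  {u ∈ VSet k r i | ¬IsWeakConnected k u ∧ OnRightSide k u (umin k u)}

/-- `U^r_{i,w̄c,left}`. -/
def USetNWCL (k r : ℕ) (i : ℤ) : Set (Word k) :=
  {u ∈ USet k r i | ¬IsWeakConnected k u ∧ OnLeftSide k u (umin k u)}

/-- `U^r_{i,w̄c,right}`. -/
def USetNWCR (k r : ℕ) (i : ℤ) : Set (Word k) :=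
  {u ∈ USet k r i | ¬IsWeakConnected k u ∧ OnRightSide k u (umin k u)}

/-! ## The algebras `𝒜_k`, `ℋ_k`, `𝒩_k` -/

/-- The defining relations of `𝒜_k`. -/
inductive AkRel (k : ℕ) : FreeAlgebra ℤ (Idx k) → FreeAlgebra ℤ (Idx k) → Prop
  | braid (i : Idx k) :
      AkRel k (FreeAlgebra.ι ℤ i * FreeAlgebra.ι ℤ (i + 1) * FreeAlgebra.ι ℤ i)
        (FreeAlgebra.ι ℤ (i + 1) * FreeAlgebra.ι ℤ i * FreeAlgebra.ι ℤ (i + 1))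
  | comm (i j : Idx k) (h1 : i - j ≠ 1) (h2 : j - i ≠ 1) :
      AkRel k (FreeAlgebra.ι ℤ i * FreeAlgebra.ι ℤ j)
        (FreeAlgebra.ι ℤ j * FreeAlgebra.ι ℤ i)

/-- The algebra `𝒜_k`. -/
abbrev Ak (k : ℕ) := RingQuot (AkRel k)

/-- The generator `A_i` of `𝒜_k`. -/
def Agen (k : ℕ) (i : Idx k) : Ak k := RingQuot.mkAlgHom ℤ (AkRel k) (FreeAlgebra.ι ℤ i)

/-- The element `A_{i₁} ⋯ A_{i_m}` of `𝒜_k` associated to a word. -/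
def Aword (k : ℕ) (u : Word k) : Ak k := (u.map (Agen k)).prod

/-- The defining relations of the 0-Hecke algebra `ℋ_k`. -/
inductive HkRel (k : ℕ) : FreeAlgebra ℤ (Idx k) → FreeAlgebra ℤ (Idx k) → Prop
  | braid (i : Idx k) :
      HkRel k (FreeAlgebra.ι ℤ i * FreeAlgebra.ι ℤ (i + 1) * FreeAlgebra.ι ℤ i)
        (FreeAlgebra.ι ℤ (i + 1) * FreeAlgebra.ι ℤ i * FreeAlgebra.ι ℤ (i + 1))
  | comm (i j : Idx k) (h1 : i - j ≠ 1) (h2 : j - i ≠ 1) :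
      HkRel k (FreeAlgebra.ι ℤ i * FreeAlgebra.ι ℤ j)
        (FreeAlgebra.ι ℤ j * FreeAlgebra.ι ℤ i)
  | sq (i : Idx k) :
      HkRel k (FreeAlgebra.ι ℤ i * FreeAlgebra.ι ℤ i) (-(FreeAlgebra.ι ℤ i))

/-- The 0-Hecke algebra `ℋ_k`. -/
abbrev Hk (k : ℕ) := RingQuot (HkRel k)

/-- The generator `H_i`. -/
def Hgen (k : ℕ) (i : Idx k) : Hk k := RingQuot.mkAlgHom ℤ (HkRel k) (FreeAlgebra.ι ℤ i)

/-- The element `H_{i₁} ⋯ H_{i_m}`. -/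
def Hword (k : ℕ) (u : Word k) : Hk k := (u.map (Hgen k)).prod

/-- The defining relations of the nilCoxeter algebra `𝒩_k`. -/
inductive NkRel (k : ℕ) : FreeAlgebra ℤ (Idx k) → FreeAlgebra ℤ (Idx k) → Prop
  | braid (i : Idx k) :
      NkRel k (FreeAlgebra.ι ℤ i * FreeAlgebra.ι ℤ (i + 1) * FreeAlgebra.ι ℤ i)
        (FreeAlgebra.ι ℤ (i + 1) * FreeAlgebra.ι ℤ i * FreeAlgebra.ι ℤ (i + 1))
  | comm (i j : Idx k) (h1 : i - j ≠ 1) (h2 : j - i ≠ 1) :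
      NkRel k (FreeAlgebra.ι ℤ i * FreeAlgebra.ι ℤ j)
        (FreeAlgebra.ι ℤ j * FreeAlgebra.ι ℤ i)
  | sq (i : Idx k) :
      NkRel k (FreeAlgebra.ι ℤ i * FreeAlgebra.ι ℤ i) 0

/-- The nilCoxeter algebra `𝒩_k`. -/
abbrev Nk (k : ℕ) := RingQuot (NkRel k)

/-- The generator `N_i`. -/
def Ngen (k : ℕ) (i : Idx k) : Nk k := RingQuot.mkAlgHom ℤ (NkRel k) (FreeAlgebra.ι ℤ i)

/-- The element `N_{i₁} ⋯ N_{i_m}`. -/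
def Nword (k : ℕ) (u : Word k) : Nk k := (u.map (Ngen k)).prod

/-! ## The affine symmetric group -/

/-- The relators of the affine symmetric group `S̃_{k+1}`. -/
def CoxRels (k : ℕ) : Set (FreeGroup (Idx k)) :=
  {g | (∃ i : Idx k, g = FreeGroup.of i * FreeGroup.of i) ∨
    (∃ i : Idx k,
      g = FreeGroup.of i * FreeGroup.of (i + 1) * FreeGroup.of i *
        (FreeGroup.of (i + 1) * FreeGroup.of i * FreeGroup.of (i + 1))⁻¹) ∨
    (∃ i j : Idx k, i - j ≠ 1 ∧ j - i ≠ 1 ∧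
      g = FreeGroup.of i * FreeGroup.of j * (FreeGroup.of j * FreeGroup.of i)⁻¹)}

/-- The affine symmetric group `S̃_{k+1}`. -/
abbrev AffS (k : ℕ) := PresentedGroup (CoxRels k)

/-- The generator `s_i`. -/
def sgen (k : ℕ) (i : Idx k) : AffS k := PresentedGroup.of i

/-- The product `s_{i₁} ⋯ s_{i_m}`. -/
def sword (k : ℕ) (u : Word k) : AffS k := (u.map (sgen k)).prod

/-- The Coxeter length of `w ∈ S̃_{k+1}`. -/
def len (k : ℕ) (w : AffS k) : ℕ :=
  sInf {m | ∃ u : Word k, u.length = m ∧ sword k u = w}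

/-- `u` is a reduced word. -/
def IsReducedWord (k : ℕ) (u : Word k) : Prop := len k (sword k u) = u.length

/-- The finite symmetric group `S_{k+1} = ⟨s_1, …, s_k⟩` inside `S̃_{k+1}`. -/
def FinSub (k : ℕ) : Subgroup (AffS k) :=
  Subgroup.closure {g | ∃ i : Idx k, i ≠ 0 ∧ g = sgen k i}

/-- `w` is a minimal-length coset representative of `S̃_{k+1}/S_{k+1}` (a Grassmannian
element). -/
def IsGrassmannian (k : ℕ) (w : AffS k) : Prop :=
  ∀ v : AffS k, w⁻¹ * v ∈ FinSub k → len k w ≤ len k v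

/-! ## Anti-weak hook words -/

/-- Anti-weak hook word, first form: `i₁ < ⋯ < i_j > i_{j+1} > ⋯ > i_m`. -/
def IsAntiHookV (k : ℕ) (u : Word k) : Prop :=
  supp k u ≠ Finset.univ ∧
    ∃ (ds as : List ℕ) (v : ℕ),
      posList k u = ds ++ v :: as ∧
        List.Chain' (· < ·) (ds ++ [v]) ∧ List.Chain' (· > ·) (v :: as)

/-- Anti-weak hook word, second form: `i₁ < ⋯ < i_j = i_{j+1} > ⋯ > i_m`. -/
def IsAntiHookU (k : ℕ) (u : Word k) : Prop :=
  supp k u ≠ Finset.univ ∧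
    ∃ (ds as : List ℕ) (v : ℕ),
      posList k u = ds ++ v :: v :: as ∧
        List.Chain' (· < ·) (ds ++ [v]) ∧ List.Chain' (· > ·) (v :: as)

/-- Anti-weak hook word. -/
def IsAntiWeakHook (k : ℕ) (u : Word k) : Prop := IsAntiHookV k u ∨ IsAntiHookU k u

/-- Length of the maximal strictly increasing (w.r.t. `I_{supp u}`) initial segment of `u`
(= the left side of an anti-weak hook word). -/
def incPrefixLen (k : ℕ) (u : Word k) : ℕ :=
  sSup {n | n ≤ u.length ∧
    List.Chain' (fun a b => pos k (supp k u) a < pos k (supp k u) b) (u.take n)}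

/-- Length of the maximal strictly increasing (w.r.t. `I_{supp u}`) final segment of `u`
(= the right side of a weak hook word). -/
def incSuffixLen (k : ℕ) (u : Word k) : ℕ :=
  sSup {n | n ≤ u.length ∧
    List.Chain' (fun a b => pos k (supp k u) a < pos k (supp k u) b)
      (u.drop (u.length - n))}

/-! ## Noncommutative symmetric functions in `𝒜_k` -/

/-- The word underlying the cyclically decreasing element `d_A` (letters of `A` in decreasing
position order, so that `A_{i+1}` occurs before `A_i` whenever `i, i+1 ∈ A`). -/
def dwordOf (k : ℕ) (A : Finset (Idx k)) : Word k :=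
  (((A.image (pos k A)).sort (· ≤ ·)).reverse).map fun n => gap k A + 1 + (n : Idx k)

/-- The word underlying the cyclically increasing element `i_A`. -/
def iwordOf (k : ℕ) (A : Finset (Idx k)) : Word k :=
  ((A.image (pos k A)).sort (· ≤ ·)).map fun n => gap k A + 1 + (n : Idx k)

/-- The noncommutative homogeneous symmetric function `h_r = Σ_{|A| = r} d_A`. -/
def hFun (k r : ℕ) : Ak k :=
  ∑ A ∈ Finset.powersetCard r (Finset.univ : Finset (Idx k)), Aword k (dwordOf k A)

/-- The noncommutative elementary symmetric function `e_r = Σ_{|A| = r} i_A`. -/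
def eFun (k r : ℕ) : Ak k :=
  ∑ A ∈ Finset.powersetCard r (Finset.univ : Finset (Idx k)), Aword k (iwordOf k A)

/-- The noncommutative hook Schur function `s_{(r−i,1^i)}`. -/
def sHookFun (k r i : ℕ) : Ak k :=
  ∑ j ∈ Finset.range (i + 1), ((-1 : ℤ) ^ j) • (hFun k (r - i + j) * eFun k (i - j))

/-- The noncommutative power sum `p_r`. -/
def pFun (k r : ℕ) : Ak k :=
  ∑ i ∈ Finset.range r, ((-1 : ℤ) ^ i) • sHookFun k r i

/-! ## Actions on the affine symmetric group -/

/-- The star action of a generator: `A_i * w = s_i w` if `l(s_i w) > l(w)`, else `w`. -/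
def starG (k : ℕ) (i : Idx k) (w : AffS k) : AffS k :=
  if len k w < len k (sgen k i * w) then sgen k i * w else w

/-- The star action of a word: `A_{i₁}⋯A_{i_m} * w = A_{i₁} * (⋯ * (A_{i_m} * w))`. -/
def starW (k : ℕ) (u : Word k) (w : AffS k) : AffS k := u.foldr (starG k) w

/-- The dot action of a generator, with values in `S̃_{k+1} ∪ {0}`. -/
def dotG (k : ℕ) (i : Idx k) : Option (AffS k) → Option (AffS k)
  | none => none
  | some w => if len k w < len k (sgen k i * w) then some (sgen k i * w) else none

/-- The dot action of a word. -/
def dotW (k : ℕ) (u : Word k) (o : Option (AffS k)) : Option (AffS k) :=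
  u.foldr (dotG k) o

/-- Extension of an action datum `act : generator → S̃ → S̃ ∪ {0}` to `S̃ ∪ {0}`. -/
def actExt (k : ℕ) (act : Idx k → AffS k → Option (AffS k)) (i : Idx k) :
    Option (AffS k) → Option (AffS k)
  | none => none
  | some w => act i w

/-- Extension of an action datum to words. -/
def actW (k : ℕ) (act : Idx k → AffS k → Option (AffS k)) (u : Word k)
    (o : Option (AffS k)) : Option (AffS k) :=
  u.foldr (actExt k act) o

/-! ## Rings and coefficients -/

/-- `(−1)^n` for an integer exponent `n`, in any ring. -/
def msign (R : Type*) [Ring R] (n : ℤ) : R := (((-1 : Rˣ) ^ n : Rˣ) : R)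

/-- The power sum `p^R_r = Σ_{i=0}^{r−1} Σ_{j=0}^{i} (−1)^{i+j} h^R_{r−i+j} e^R_{i−j}` built from
Pieri data in a commutative ring. -/
def pR {R : Type*} [CommRing R] (h e : ℕ → R) (r : ℕ) : R :=
  ∑ i ∈ Finset.range r, ∑ j ∈ Finset.range (i + 1),
    ((-1 : ℤ) ^ (i + j)) • (h (r - i + j) * e (i - j))

/-- The integer coefficient
`Σ_{i=0}^{r−1} (−1)^i |V^r_{i,wc} ∩ P| + Σ_{i=1}^{r−1} (−1)^i (r−i) |U^r_{i−1,wc} ∩ P|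
 + Σ_{i=1}^{r−2} (−1)^i |U^r_{i−1,w̄c,left} ∩ P|`. -/
def MNcoeff (k r : ℕ) (P : Word k → Prop) : ℤ :=
  (∑ i ∈ Finset.range r, (-1 : ℤ) ^ i * ({u ∈ VSetWC k r (i : ℤ) | P u}.ncard : ℤ)) +
    (∑ i ∈ Finset.Icc 1 (r - 1),
      (-1 : ℤ) ^ i * ((r : ℤ) - i) * ({u ∈ USetWC k r ((i : ℤ) - 1) | P u}.ncard : ℤ)) +
    ∑ i ∈ Finset.Icc 1 (r - 2),
      (-1 : ℤ) ^ i * ({u ∈ USetNWCL k r ((i : ℤ) - 1) | P u}.ncard : ℤ)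

/-- The integer coefficient `Σ_{i=0}^{r−1} (−1)^i |V^r_{i,c} ∩ P|`. -/
def kcoeff (k r : ℕ) (P : Word k → Prop) : ℤ :=
  ∑ i ∈ Finset.range r, (-1 : ℤ) ^ i * ({u ∈ VSetC k r (i : ℤ) | P u}.ncard : ℤ)

/-! ## Partitions, cores, bounded partitions -/

/-- A cell of a Young diagram: (row, column), `0`-indexed. -/
abbrev Cell := ℕ × ℕ

/-- A (finite) Young diagram, as a finite lower set of cells. -/
def IsYoung (S : Set Cell) : Prop :=
  S.Finite ∧ ∀ p ∈ S, ∀ q : Cell, q.1 ≤ p.1 → q.2 ≤ p.2 → q ∈ S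

/-- The `(k+1)`-residue of a cell `(i,j)`, i.e. `j − i mod (k+1)`. -/
def res (k : ℕ) (c : Cell) : Idx k := (c.2 : Idx k) - (c.1 : Idx k)

/-- The hook length of a cell: arm + leg + 1. -/
def hookLen (S : Set Cell) (c : Cell) : ℕ :=
  {j | c.2 < j ∧ (c.1, j) ∈ S}.ncard + {i | c.1 < i ∧ (i, c.2) ∈ S}.ncard + 1

/-- A `(k+1)`-core: a partition with no cell of hook length `k+1`. -/
def IsCore (k : ℕ) (S : Set Cell) : Prop :=
  IsYoung S ∧ ∀ c ∈ S, hookLen S c ≠ k + 1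

/-- A `k`-bounded partition: every part is at most `k`. -/
def IsBounded (k : ℕ) (S : Set Cell) : Prop :=
  IsYoung S ∧ ∀ c ∈ S, c.2 < k

/-- A removable corner of `S`. -/
def Removable (S : Set Cell) (c : Cell) : Prop :=
  c ∈ S ∧ (c.1 + 1, c.2) ∉ S ∧ (c.1, c.2 + 1) ∉ S

/-- An addable corner of `S`: a cell not in `S` whose addition yields a partition. -/
def Addable (S : Set Cell) (c : Cell) : Prop :=
  c ∉ S ∧ IsYoung (S ∪ {c})

/-- The map `𝔭` from `(k+1)`-cores to `k`-bounded partitions: row `i` of `𝔭(κ)` has as many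
cells as there are cells of hook length at most `k` in row `i` of `κ`. -/
def pMap (k : ℕ) (S : Set Cell) : Set Cell :=
  {c | c.2 < {j | (c.1, j) ∈ S ∧ hookLen S (c.1, j) ≤ k}.ncard}

/-- The inverse bijection `𝔭^{-1}` from `k`-bounded partitions to `(k+1)`-cores. -/
def pInv (k : ℕ) (lam : Set Cell) : Set Cell :=
  Function.invFunOn (pMap k) {S | IsCore k S} lam

/-- The transpose (conjugate) of a diagram. -/
def transposeSet (S : Set Cell) : Set Cell := {c | (c.2, c.1) ∈ S}

/-- The `k`-conjugate `λ^{(k)} = 𝔭((𝔭^{-1} λ)^t)`. -/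
def kconj (k : ℕ) (lam : Set Cell) : Set Cell := pMap k (transposeSet (pInv k lam))

/-- A skew shape is a ribbon if it contains no `2×2` square. -/
def IsRibbon (D : Set Cell) : Prop :=
  ∀ c : Cell, ¬((c.1, c.2) ∈ D ∧ (c.1 + 1, c.2) ∈ D ∧
    (c.1, c.2 + 1) ∈ D ∧ (c.1 + 1, c.2 + 1) ∈ D)

/-- A vertical strip: no two cells in the same row. -/
def IsVStrip (D : Set Cell) : Prop :=
  ∀ c ∈ D, ∀ c' ∈ D, c.1 = c'.1 → c = c'

/-- A horizontal strip: no two cells in the same column. -/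
def IsHStrip (D : Set Cell) : Prop :=
  ∀ c ∈ D, ∀ c' ∈ D, c.2 = c'.2 → c = c'

/-- The height of a skew shape: the number of occupied rows minus the number of connected
components; each connected component is counted by its unique last occupied row, i.e. an
occupied row sharing no column with the next row. -/
def htSkew (D : Set Cell) : ℕ :=
  {i : ℕ | ∃ j, (i, j) ∈ D}.ncard -
    {i : ℕ | (∃ j, (i, j) ∈ D) ∧ ¬∃ j, (i, j) ∈ D ∧ (i + 1, j) ∈ D}.ncard

/-- The set of `(k+1)`-residues of the cells of a skew shape. -/
def residSupp (k : ℕ) (D : Set Cell) : Finset (Idx k) :=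
  Set.Finite.toFinset (Set.toFinite (res k '' D))

/-! ## Star and dot actions on cores and on `k`-bounded partitions -/

/-- The star action of `A_i` on `(k+1)`-cores together with `0`. -/
def starC (k : ℕ) (i : Idx k) : Option (Set Cell) → Option (Set Cell)
  | none => none
  | some S =>
    if ∃ c, Addable S c ∧ res k c = i then some (S ∪ {c | Addable S c ∧ res k c = i})
    else if ∃ c, Removable S c ∧ res k c = i then some S
    else none

/-- The star action of a word on cores. -/
def starCW (k : ℕ) (u : Word k) (o : Option (Set Cell)) : Option (Set Cell) :=
  u.foldr (starC k) o

/-- The star action of a word on `k`-bounded partitions, transported through `𝔭`. -/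
def starB (k : ℕ) (u : Word k) (lam : Set Cell) : Option (Set Cell) :=
  (starCW k u (some (pInv k lam))).map (pMap k)

/-- The dot action of `A_i` on `(k+1)`-cores together with `0`. -/
def dotC (k : ℕ) (i : Idx k) : Option (Set Cell) → Option (Set Cell)
  | none => none
  | some S =>
    if ∃ c, Addable S c ∧ res k c = i then some (S ∪ {c | Addable S c ∧ res k c = i})
    else none

/-- The dot action of a word on cores. -/
def dotCW (k : ℕ) (u : Word k) (o : Option (Set Cell)) : Option (Set Cell) :=
  u.foldr (dotC k) o

/-- The dot action of a word on `k`-bounded partitions, transported through `𝔭`. -/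
def dotB (k : ℕ) (u : Word k) (lam : Set Cell) : Option (Set Cell) :=
  (dotCW k u (some (pInv k lam))).map (pMap k)

/-- The number of maximal segments of consecutive letters (w.r.t. the positions for `S`) of a
word `V`. -/
def numSegments (k : ℕ) (S : Finset (Idx k)) (V : Word k) : ℕ :=
  if V.length = 0 then 0
  else ((V.zip V.tail).countP fun p => decide (pos k S p.2 ≠ pos k S p.1 + 1)) + 1

/-- Conditions (K0)–(K4) of the Murnaghan–Nakayama rule for `K`-`k`-Schur functions. -/
def Kconds (k r : ℕ) (lam mu : Set Cell) : Prop :=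
  lam ⊆ mu ∧ kconj k lam ⊆ kconj k mu ∧
    (mu \ lam).ncard ≤ r ∧
    IsRibbon (pInv k mu \ pInv k lam) ∧
    (IsKConnectedSet k (residSupp k (pInv k mu \ pInv k lam)) ∨
      (residSupp k (pInv k mu \ pInv k lam)).card < r) ∧
    htSkew (mu \ lam) + htSkew (kconj k mu \ kconj k lam) < r

/-- Conditions (k0)–(k4) of the Murnaghan–Nakayama rule for `k`-Schur functions. -/
def kconds (k r : ℕ) (lam mu : Set Cell) : Prop :=
  lam ⊆ mu ∧ kconj k lam ⊆ kconj k mu ∧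
    (mu \ lam).ncard = r ∧
    IsRibbon (pInv k mu \ pInv k lam) ∧
    IsKConnectedSet k (residSupp k (pInv k mu \ pInv k lam)) ∧
    htSkew (mu \ lam) + htSkew (kconj k mu \ kconj k lam) = r - 1


/-! ## Proof -/

/-- conjugation step -/
def cstep (k : ℕ) (i : Idx k) (p : AffS k × ZMod 2) : AffS k × ZMod 2 :=
  (sgen k i * p.1 * sgen k i, p.2 + if p.1 = sgen k i then 1 else 0)

lemma sgen_sq (k : ℕ) (i : Idx k) : sgen k i * sgen k i = 1 := by
  have h : FreeGroup.of i * FreeGroup.of i ∈ CoxRels k := Or.inl ⟨i, rfl⟩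
  have := PresentedGroup.one_of_mem h
  simpa [sgen, PresentedGroup.of] using this

lemma sgen_braid (k : ℕ) (i : Idx k) :
    sgen k i * sgen k (i+1) * sgen k i = sgen k (i+1) * sgen k i * sgen k (i+1) := by
  have h : FreeGroup.of i * FreeGroup.of (i + 1) * FreeGroup.of i *
        (FreeGroup.of (i + 1) * FreeGroup.of i * FreeGroup.of (i + 1))⁻¹ ∈ CoxRels k :=
    Or.inr (Or.inl ⟨i, rfl⟩)
  have := PresentedGroup.one_of_mem h
  rw [map_mul, map_inv, mul_inv_eq_one] at this
  simpa [sgen, PresentedGroup.of] using this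

lemma sgen_comm (k : ℕ) (i j : Idx k) (h1 : i - j ≠ 1) (h2 : j - i ≠ 1) :
    sgen k i * sgen k j = sgen k j * sgen k i := by
  have h : FreeGroup.of i * FreeGroup.of j * (FreeGroup.of j * FreeGroup.of i)⁻¹ ∈ CoxRels k :=
    Or.inr (Or.inr ⟨i, j, h1, h2, rfl⟩)
  have := PresentedGroup.one_of_mem h
  rw [map_mul, map_inv, mul_inv_eq_one] at this
  simpa [sgen, PresentedGroup.of] using this

lemma invol_flip {G : Type*} [Group G] {s x y : G} (hs : s * s = 1) :
    s * x * s = y ↔ x = s * y * s := by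
  have e : s⁻¹ = s := inv_eq_of_mul_eq_one_left hs
  constructor
  · rintro rfl
    calc x = (s * s) * x * (s * s) := by simp [hs]
      _ = _ := by group
  · rintro rfl
    calc s * (s * y * s) * s = (s * s) * y * (s * s) := by group
      _ = _ := by simp [hs]

lemma cstep_sq (k : ℕ) (i : Idx k) (p : AffS k × ZMod 2) : cstep k i (cstep k i p) = p := by
  obtain ⟨t, e⟩ := p
  have hs := sgen_sq k i
  have h1 : sgen k i * (sgen k i * t * sgen k i) * sgen k i = t := (invol_flip hs).2 rfl
  have h2 : sgen k i * t * sgen k i = sgen k i ↔ t = sgen k i := by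
    rw [invol_flip hs]; simp [hs]
  simp only [cstep, h1, h2, Prod.mk.injEq, true_and]
  split_ifs
  · rw [add_assoc]; have : (1:ZMod 2) + 1 = 0 := by decide
    simp [this]
  · simp

lemma cstep_comm (k : ℕ) (i j : Idx k) (h : sgen k i * sgen k j = sgen k j * sgen k i)
    (p : AffS k × ZMod 2) : cstep k i (cstep k j p) = cstep k j (cstep k i p) := by
  obtain ⟨t, e⟩ := p
  have hi := sgen_sq k i
  have hj := sgen_sq k j
  have h2 : sgen k i * t * sgen k i = sgen k j ↔ t = sgen k j := by
    rw [invol_flip hi, h, mul_assoc, hi, mul_one]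
  have h3 : sgen k j * t * sgen k j = sgen k i ↔ t = sgen k i := by
    rw [invol_flip hj, ← h, mul_assoc, hj, mul_one]
  simp only [cstep, h2, h3, Prod.mk.injEq]
  refine ⟨?_, by ring⟩
  calc sgen k i * (sgen k j * t * sgen k j) * sgen k i
      = (sgen k i * sgen k j) * t * (sgen k j * sgen k i) := by group
    _ = (sgen k j * sgen k i) * t * (sgen k i * sgen k j) := by rw [h]
    _ = _ := by group

lemma braid_aux {G : Type*} [Group G] {a b t : G} (hi : a * a = 1) (hj : b * b = 1)
    (h : a * b * a = b * a * b) :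
    (a * (b * (a * t * a) * b) * a = b * (a * (b * t * b) * a) * b) ∧
    (a * t * a = b ↔ t = a * b * a) ∧ (b * t * b = a ↔ t = a * b * a) ∧
    (b * (a * t * a) * b = a ↔ t = b) ∧ (a * (b * t * b) * a = b ↔ t = a) := by
  have e1 : a * (b * a * b) * a = b := by
    rw [← h]
    calc a * (a * b * a) * a = (a * a) * b * (a * a) := by group
      _ = b := by simp [hi]
  have e2 : b * (a * b * a) * b = a := by
    rw [h]
    calc b * (b * a * b) * b = (b * b) * a * (b * b) := by group
      _ = a := by simp [hj]
  refine ⟨?_, ?_, ?_, ?_, ?_⟩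
  · calc a * (b * (a * t * a) * b) * a = (a * b * a) * t * (a * b * a) := by group
      _ = (b * a * b) * t * (b * a * b) := by rw [h]
      _ = _ := by group
  · rw [invol_flip hi]
  · rw [invol_flip hj, h]
  · rw [invol_flip hj, invol_flip hi, e1]
  · rw [invol_flip hi, invol_flip hj, e2]

lemma cstep_braid (k : ℕ) (i j : Idx k)
    (h : sgen k i * sgen k j * sgen k i = sgen k j * sgen k i * sgen k j)
    (p : AffS k × ZMod 2) :
    cstep k i (cstep k j (cstep k i p)) = cstep k j (cstep k i (cstep k j p)) := by
  obtain ⟨t, e⟩ := p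
  obtain ⟨h1, h2, h3, h4, h5⟩ := braid_aux (t := t) (sgen_sq k i) (sgen_sq k j) h
  simp only [cstep, h1, h2, h3, h4, h5, Prod.mk.injEq, true_and]
  ring

/-- cstep as a permutation -/
def cperm (k : ℕ) (i : Idx k) : Equiv.Perm (AffS k × ZMod 2) :=
  ⟨cstep k i, cstep k i, cstep_sq k i, cstep_sq k i⟩

lemma cperm_rels (k : ℕ) : ∀ g ∈ CoxRels k, FreeGroup.lift (cperm k) g = 1 := by
  rintro g (⟨i, rfl⟩ | ⟨i, rfl⟩ | ⟨i, j, h1, h2, rfl⟩)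
  · ext1 p
    simp only [map_mul, FreeGroup.lift_apply_of, Equiv.Perm.mul_apply]
    exact cstep_sq k i p
  · rw [map_mul, map_inv, mul_inv_eq_one]
    ext1 p
    simp only [map_mul, FreeGroup.lift_apply_of, Equiv.Perm.mul_apply]
    exact cstep_braid k i (i+1) (sgen_braid k i) p
  · rw [map_mul, map_inv, mul_inv_eq_one]
    ext1 p
    simp only [map_mul, FreeGroup.lift_apply_of, Equiv.Perm.mul_apply]
    exact cstep_comm k i j (sgen_comm k i j h1 h2) p

/-- The reflection cocycle action. -/
def cact (k : ℕ) : AffS k →* Equiv.Perm (AffS k × ZMod 2) :=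
  PresentedGroup.toGroup (cperm_rels k)

lemma cact_sgen (k : ℕ) (i : Idx k) (p) : cact k (sgen k i) p = cstep k i p := by
  have : cact k (sgen k i) = cperm k i := by
    simp [cact, sgen]
  rw [this]; rfl

/-- cocycle -/
def eta (k : ℕ) (w t : AffS k) : ZMod 2 := (cact k w (t, 0)).2

lemma cact_add (k : ℕ) (u : Word k) (t : AffS k) (e : ZMod 2) :
    cact k (sword k u) (t, e) = (sword k u * t * (sword k u)⁻¹, eta k (sword k u) t + e) := by
  induction u generalizing e with
  | nil => simp [sword, eta]
  | cons a u ih =>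
    have e1 : sword k (a :: u) = sgen k a * sword k u := by simp [sword]
    have e2 : (sgen k a)⁻¹ = sgen k a := inv_eq_of_mul_eq_one_left (sgen_sq k a)
    have e3 : eta k (sword k (a :: u)) t = (cstep k a (cact k (sword k u) (t, 0))).2 := by
      rw [eta, e1, map_mul, Equiv.Perm.mul_apply, cact_sgen]
    rw [e3, e1, map_mul, Equiv.Perm.mul_apply, ih, ih, cact_sgen]
    refine Prod.ext ?_ ?_
    · simp [cstep, e2, mul_assoc]
    · simp only [cstep]; ring

lemma eta_cons (k : ℕ) (a : Idx k) (u : Word k) (t : AffS k) :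
    eta k (sgen k a * sword k u) t = eta k (sword k u) t +
      if sword k u * t * (sword k u)⁻¹ = sgen k a then 1 else 0 := by
  conv_lhs => rw [eta, map_mul, Equiv.Perm.mul_apply, cact_add, cact_sgen]
  simp [cstep]

lemma exists_word (k : ℕ) (w : AffS k) : ∃ u : Word k, sword k u = w := by
  obtain ⟨x, rfl⟩ := PresentedGroup.mk_surjective _ w
  induction x using FreeGroup.induction_on with
  | C1 => exact ⟨[], by simp [sword]⟩
  | of i => exact ⟨[i], by simp [sword, sgen, PresentedGroup.of]⟩
  | inv_of i h =>
    refine ⟨[i], ?_⟩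
    rw [map_inv, eq_comm, inv_eq_iff_mul_eq_one]
    have := sgen_sq k i
    simpa [sword, sgen, PresentedGroup.of] using this
  | mul x y hx hy =>
    obtain ⟨u, hu⟩ := hx
    obtain ⟨v, hv⟩ := hy
    exact ⟨u ++ v, by rw [map_mul, ← hu, ← hv]; simp [sword]⟩

lemma exists_red (k : ℕ) (w : AffS k) : ∃ u : Word k, u.length = len k w ∧ sword k u = w := by
  have : len k w ∈ {m | ∃ u : Word k, u.length = m ∧ sword k u = w} := by
    apply Nat.sInf_mem
    obtain ⟨u, hu⟩ := exists_word k w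
    exact ⟨_, u, rfl, hu⟩
  exact this

lemma len_le (k : ℕ) (u : Word k) : len k (sword k u) ≤ u.length :=
  Nat.sInf_le ⟨u, rfl, rfl⟩

lemma len_mul_le (k : ℕ) (i : Idx k) (w : AffS k) : len k (sgen k i * w) ≤ len k w + 1 := by
  obtain ⟨u, hu, rfl⟩ := exists_red k w
  have := len_le k (i :: u)
  simp only [sword, List.map_cons, List.prod_cons, List.length_cons] at this
  rw [hu] at this
  exact this

lemma del (k : ℕ) (u : Word k) (t : AffS k) (h : eta k (sword k u) t ≠ 0) :
    ∃ v : Word k, v.length < u.length ∧ sword k v = sword k u * t := by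
  induction u with
  | nil => simp [sword, eta] at h
  | cons a u ih =>
    have e1 : sword k (a :: u) = sgen k a * sword k u := by simp [sword]
    rw [e1, eta_cons] at h
    rw [e1]
    by_cases h0 : eta k (sword k u) t = 0
    · rw [h0] at h
      have h1 : sword k u * t * (sword k u)⁻¹ = sgen k a := by
        by_contra h1; simp [h1] at h
      refine ⟨u, by simp, ?_⟩
      rw [mul_inv_eq_iff_eq_mul] at h1
      rw [mul_assoc, h1, ← mul_assoc, sgen_sq, one_mul]
    · obtain ⟨v, hv, hv'⟩ := ih h0
      exact ⟨a :: v, by simpa using hv, by simp only [sword, List.map_cons, List.prod_cons] at *; rw [hv', mul_assoc]⟩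

lemma len_inv_le (k : ℕ) (w : AffS k) : len k w⁻¹ ≤ len k w := by
  obtain ⟨u, hu, rfl⟩ := exists_red k w
  have : (sword k u)⁻¹ = sword k u.reverse := by
    clear hu
    induction u with
    | nil => simp [sword]
    | cons a u ih =>
      have e2 : (sgen k a)⁻¹ = sgen k a := inv_eq_of_mul_eq_one_left (sgen_sq k a)
      simp only [sword, List.map_cons, List.prod_cons, mul_inv_rev, List.reverse_cons,
        List.map_append, List.prod_append, List.map_nil, List.prod_nil, mul_one] at *
      rw [ih, e2]
  rw [this, ← hu, ← List.length_reverse]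
  exact len_le k _

lemma len_inv (k : ℕ) (w : AffS k) : len k w⁻¹ = len k w :=
  le_antisymm (len_inv_le k w) (by simpa using len_inv_le k w⁻¹)

lemma eta_right (k : ℕ) (w : AffS k) (j : Idx k) (t : AffS k) :
    eta k (w * sgen k j) t = eta k w (sgen k j * t * sgen k j) + if t = sgen k j then 1 else 0 := by
  obtain ⟨u, rfl⟩ := exists_word k w
  conv_lhs => rw [eta, map_mul, Equiv.Perm.mul_apply, cact_sgen, cstep, cact_add]
  simp

lemma desc_iff (k : ℕ) (i : Idx k) (w : AffS k) :
    len k w < len k (sgen k i * w) ↔ eta k w⁻¹ (sgen k i) = 0 := by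
  have key : ∀ w : AffS k, eta k w⁻¹ (sgen k i) ≠ 0 → len k (sgen k i * w) < len k w := by
    intro w h
    obtain ⟨u, hu, hu'⟩ := exists_red k w⁻¹
    rw [← hu'] at h
    obtain ⟨v, hv, hv'⟩ := del k u _ h
    have := len_le k v
    have e2 : (sgen k i)⁻¹ = sgen k i := inv_eq_of_mul_eq_one_left (sgen_sq k i)
    have e3 : sword k v = (sgen k i * w)⁻¹ := by rw [hv', hu', mul_inv_rev, e2]
    rw [e3, len_inv] at this
    rw [len_inv] at hu
    omega
  constructor
  · intro h
    by_contra h0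
    have := key w h0
    omega
  · intro h
    have e2 : (sgen k i)⁻¹ = sgen k i := inv_eq_of_mul_eq_one_left (sgen_sq k i)
    have := key (sgen k i * w) (by
      rw [mul_inv_rev, e2, eta_right, sgen_sq, one_mul, h]; simp)
    rwa [← mul_assoc, sgen_sq, one_mul] at this

lemma starG_comm (k : ℕ) (i j : Idx k) (h1 : i - j ≠ 1) (h2 : j - i ≠ 1) (w : AffS k) :
    starG k i (starG k j w) = starG k j (starG k i w) := by
  by_cases hij : sgen k i = sgen k j
  · simp only [starG, hij]
  have hc := sgen_comm k i j h1 h2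
  have aux : ∀ i j : Idx k, sgen k i ≠ sgen k j → sgen k i * sgen k j = sgen k j * sgen k i →
      ∀ w, eta k (sgen k j * w)⁻¹ (sgen k i) = eta k w⁻¹ (sgen k i) := by
    intro i j hij hc w
    have e2 : (sgen k j)⁻¹ = sgen k j := inv_eq_of_mul_eq_one_left (sgen_sq k j)
    rw [mul_inv_rev, e2, eta_right, if_neg hij, ← hc, mul_assoc, sgen_sq, mul_one, add_zero]
  have a1 := aux i j hij hc w
  have a2 := aux j i (Ne.symm hij) hc.symm w
  simp only [starG, desc_iff]
  by_cases c1 : eta k w⁻¹ (sgen k i) = 0 <;> by_cases c2 : eta k w⁻¹ (sgen k j) = 0 <;>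
    simp only [c1, c2, a1, a2, if_true, if_false]
  rw [← mul_assoc, hc, mul_assoc]

lemma grass_of_starG (k : ℕ) (i : Idx k) (w : AffS k) (h : IsGrassmannian k (starG k i w)) :
    IsGrassmannian k w := by
  unfold starG at h
  split_ifs at h with h1
  · intro v hv
    have := h (sgen k i * v) (by simpa [mul_assoc] using hv)
    have := len_mul_le k i v
    omega
  · exact h

lemma starW_append (k : ℕ) (u v : Word k) (w : AffS k) :
    starW k (u ++ v) w = starW k u (starW k v w) := by
  simp [starW]

lemma grass_of_starW (k : ℕ) (u : Word k) (w : AffS k) (h : IsGrassmannian k (starW k u w)) :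
    IsGrassmannian k w := by
  induction u with
  | nil => exact h
  | cons a u ih => exact ih (grass_of_starG k a _ h)

lemma starW_move (k : ℕ) (a : Idx k) (p : Word k)
    (h : ∀ b ∈ p, a - b ≠ 1 ∧ b - a ≠ 1) (w : AffS k) :
    starW k p (starG k a w) = starG k a (starW k p w) := by
  induction p with
  | nil => rfl
  | cons b p ih =>
    have h1 := h b (by simp)
    have := ih (fun b hb => h b (by simp [hb]))
    simp only [starW, List.foldr_cons] at *
    rw [this, starG_comm k b a h1.2 h1.1]

lemma starW_perm (k : ℕ) (Rr : Idx k → Idx k → Prop)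
    (hR : ∀ a b, Rr a b → Rr b a → a - b ≠ 1 ∧ b - a ≠ 1 ∨ a = b) (l1 l2 : Word k)
    (hp : l1.Perm l2) (h1 : l1.Pairwise Rr) (h2 : l2.Pairwise Rr) (hn : l1.Nodup) (w : AffS k) :
    starW k l1 w = starW k l2 w := by
  induction l1 generalizing l2 with
  | nil => rw [List.nil_perm.1 hp]
  | cons a t ih =>
    obtain ⟨p, q, rfl⟩ := List.append_of_mem (hp.subset (List.mem_cons_self (a := a) (l := t)))
    have hp' : t.Perm (p ++ q) := by
      have := hp.trans List.perm_middle
      exact (List.perm_cons a).1 this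
    rw [List.pairwise_cons] at h1
    rw [List.nodup_cons] at hn
    have h2' : (p ++ q).Pairwise Rr := h2.sublist (by simp)
    have e := ih (p ++ q) hp' h1.2 h2' hn.2
    have hm : ∀ b ∈ p, a - b ≠ 1 ∧ b - a ≠ 1 := by
      intro b hb
      have hbt : b ∈ t := hp'.symm.subset (by simp [hb])
      have r1 := h1.1 b hbt
      have r2 := (List.pairwise_append.1 h2).2.2 b hb a (by simp)
      rcases hR a b r1 r2 with h | h
      · exact h
      · subst h; exact absurd hbt hn.1
    calc starW k (a :: t) w = starG k a (starW k t w) := rfl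
      _ = starG k a (starW k p (starW k q w)) := by rw [e, starW_append]
      _ = _ := by rw [starW_append, ← starW_move k a p hm]; rfl

lemma gap_not_mem (k : ℕ) (S : Finset (Idx k)) (hS : S ≠ Finset.univ) : gap k S ∉ S := by
  have h : ∃ m : ℕ, m ≤ k ∧ (m : Idx k) ∉ S := by
    by_contra hc
    push Not at hc
    apply hS
    ext x
    simp only [Finset.mem_univ, iff_true]
    have := hc x.val (Nat.lt_succ_iff.1 (ZMod.val_lt x))
    rwa [ZMod.natCast_zmod_val] at this
  unfold gap gapNat
  rw [dif_pos h]
  exact (Nat.find_spec h).2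

lemma pos_inv (k : ℕ) (S : Finset (Idx k)) (x : Idx k) :
    gap k S + 1 + ((pos k S x : ℕ) : Idx k) = x := by
  unfold pos
  rw [ZMod.natCast_zmod_val]; ring

lemma pos_inj (k : ℕ) (S : Finset (Idx k)) : Function.Injective (pos k S) := by
  intro x y h
  rw [← pos_inv k S x, h, pos_inv]

lemma pos_lt (k : ℕ) (S : Finset (Idx k)) (x : Idx k) : pos k S x < k + 1 := ZMod.val_lt _

lemma pos_cast (k : ℕ) (S : Finset (Idx k)) (n : ℕ) (hn : n < k + 1) :
    pos k S (gap k S + 1 + (n : Idx k)) = n := by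
  unfold pos
  rw [show gap k S + 1 + (n : Idx k) - gap k S - 1 = n by ring]
  exact ZMod.val_cast_of_lt hn

lemma pos_gap (k : ℕ) (S : Finset (Idx k)) : pos k S (gap k S) = k := by
  have := pos_cast k S k (by omega)
  rwa [add_assoc, show (1 : Idx k) + (k : Idx k) = 0 from by
    have := ZMod.natCast_self (k+1)
    push_cast at this; rw [add_comm]; exact this, add_zero] at this

lemma pos_succ (k : ℕ) (S : Finset (Idx k)) (x : Idx k) (hx : x ≠ gap k S) :
    pos k S (x + 1) = pos k S x + 1 := by
  have h1 : pos k S x ≠ k := fun h => hx (pos_inj k S (h.trans (pos_gap k S).symm))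
  have h2 := pos_lt k S x
  have := pos_cast k S (pos k S x + 1) (by omega)
  rw [Nat.cast_add, ← add_assoc, pos_inv] at this
  simpa using this

/-- increasing sorting of `A` with respect to `I_S`. -/
def srt (k : ℕ) (S A : Finset (Idx k)) : Word k :=
  ((A.image (pos k S)).sort (· ≤ ·)).map fun n : ℕ => gap k S + 1 + (n : Idx k)

lemma mem_srt (k : ℕ) (S A : Finset (Idx k)) (x : Idx k) : x ∈ srt k S A ↔ x ∈ A := by
  simp [srt, pos_inv]

lemma srt_pairwise (k : ℕ) (S A : Finset (Idx k)) :
    (srt k S A).Pairwise (fun a b => pos k S a < pos k S b) := by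
  unfold srt
  rw [List.pairwise_map]
  have h := (Finset.sortedLT_sort (A.image (pos k S))).pairwise
  refine h.imp_of_mem ?_
  intro a b ha hb hab
  have aux : ∀ n ∈ (A.image (pos k S)).sort (· ≤ ·), n < k + 1 := by
    intro n hn
    simp only [Finset.mem_sort, Finset.mem_image] at hn
    obtain ⟨x, -, rfl⟩ := hn
    exact pos_lt k S x
  rw [pos_cast k S a (aux a ha), pos_cast k S b (aux b hb)]
  exact hab

lemma srt_nodup (k : ℕ) (S A : Finset (Idx k)) : (srt k S A).Nodup :=
  (srt_pairwise k S A).imp (fun h => by rintro rfl; exact lt_irrefl _ h)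

lemma srt_length (k : ℕ) (S A : Finset (Idx k)) : (srt k S A).length = A.card := by
  rw [← List.toFinset_card_of_nodup (srt_nodup k S A)]
  congr 1; ext x; simp [mem_srt]

lemma eq_srt (k : ℕ) (S : Finset (Idx k)) (l : Word k)
    (hl : l.Pairwise (fun a b => pos k S a < pos k S b)) : l = srt k S l.toFinset := by
  have hn : l.Nodup := hl.imp (fun h => by rintro rfl; exact lt_irrefl _ h)
  have hp : l.Perm (srt k S l.toFinset) := by
    rw [List.perm_ext_iff_of_nodup hn (srt_nodup _ _ _)]
    simp [mem_srt]
  exact hp.eq_of_pairwise (fun a b _ _ h1 h2 => absurd h1 (by omega)) hl (srt_pairwise _ _ _)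

/-- never `x+1` before `x` -/
def RI (k : ℕ) (a b : Idx k) : Prop := a ≠ b + 1
/-- never `x` before `x+1` -/
def RD (k : ℕ) (a b : Idx k) : Prop := b ≠ a + 1

lemma RI_comm (k : ℕ) (a b : Idx k) (h1 : RI k a b) (h2 : RI k b a) :
    a - b ≠ 1 ∧ b - a ≠ 1 ∨ a = b := by
  left
  refine ⟨fun h => h1 (by rw [← h]; ring), fun h => h2 (by rw [← h]; ring)⟩

lemma RD_comm (k : ℕ) (a b : Idx k) (h1 : RD k a b) (h2 : RD k b a) :
    a - b ≠ 1 ∧ b - a ≠ 1 ∨ a = b := by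
  left
  refine ⟨fun h => h2 (by rw [← h]; ring), fun h => h1 (by rw [← h]; ring)⟩

lemma srt_RI (k : ℕ) (S A : Finset (Idx k)) (hA : gap k S ∉ A) : (srt k S A).Pairwise (RI k) := by
  refine (srt_pairwise k S A).imp_of_mem ?_
  rintro a b ha hb hab rfl
  rw [mem_srt] at hb
  rw [pos_succ k S b (by rintro rfl; exact hA hb)] at hab
  omega

lemma srt_RD (k : ℕ) (S A : Finset (Idx k)) (hA : gap k S ∉ A) :
    (srt k S A).reverse.Pairwise (RD k) := by
  rw [List.pairwise_reverse]
  exact srt_RI k S A hA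

lemma starW_inc (k : ℕ) (A : Finset (Idx k)) (l1 l2 : Word k) (h1 : l1.Pairwise (RI k))
    (h2 : l2.Pairwise (RI k)) (n1 : l1.Nodup) (n2 : l2.Nodup) (m1 : ∀ x, x ∈ l1 ↔ x ∈ A)
    (m2 : ∀ x, x ∈ l2 ↔ x ∈ A) (w : AffS k) : starW k l1 w = starW k l2 w := by
  refine starW_perm k (RI k) (RI_comm k) l1 l2 ?_ h1 h2 n1 w
  rw [List.perm_ext_iff_of_nodup n1 n2]
  intro x; rw [m1, m2]

lemma starW_dec (k : ℕ) (A : Finset (Idx k)) (l1 l2 : Word k) (h1 : l1.Pairwise (RD k))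
    (h2 : l2.Pairwise (RD k)) (n1 : l1.Nodup) (n2 : l2.Nodup) (m1 : ∀ x, x ∈ l1 ↔ x ∈ A)
    (m2 : ∀ x, x ∈ l2 ↔ x ∈ A) (w : AffS k) : starW k l1 w = starW k l2 w := by
  refine starW_perm k (RD k) (RD_comm k) l1 l2 ?_ h1 h2 n1 w
  rw [List.perm_ext_iff_of_nodup n1 n2]
  intro x; rw [m1, m2]

/-- the word of a pair -/
def Phi (k : ℕ) (L M : Finset (Idx k)) : Word k :=
  (srt k (L ∪ M) L).reverse ++ srt k (L ∪ M) M

lemma lift_map (k : ℕ) (l : List ℕ) :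
    (do let a ← l; pure ((a : ℕ) : Idx k)) = l.map (fun n : ℕ => (n : Idx k)) := by
  induction l with
  | nil => rfl
  | cons a l ih => simpa using ih

lemma iword_eq (k : ℕ) (A : Finset (Idx k)) : iwordOf k A = srt k A A := by
  simp only [iwordOf, srt]
  rw [lift_map, List.map_map]; rfl
lemma dword_eq (k : ℕ) (A : Finset (Idx k)) : dwordOf k A = (srt k A A).reverse := by
  simp only [dwordOf, srt]
  rw [lift_map, List.map_map, ← List.map_reverse]; rfl

lemma starW_Phi (k : ℕ) (L M : Finset (Idx k)) (h : L ∪ M ≠ Finset.univ) (w : AffS k) :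
    starW k (Phi k L M) w = starW k (dwordOf k L ++ iwordOf k M) w := by
  have hg := gap_not_mem k _ h
  rw [Finset.mem_union] at hg
  push Not at hg
  have hL : L ≠ Finset.univ := by rintro rfl; simp at h
  have hM : M ≠ Finset.univ := by rintro rfl; simp at h
  rw [Phi, starW_append, starW_append, iword_eq, dword_eq]
  rw [starW_inc k M (srt k (L ∪ M) M) (srt k M M) (srt_RI _ _ _ hg.2)
    (srt_RI _ _ _ (gap_not_mem k _ hM)) (srt_nodup _ _ _) (srt_nodup _ _ _)
    (mem_srt _ _ _) (mem_srt _ _ _)]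
  refine starW_dec k L _ _ (srt_RD _ _ _ hg.1)
    (srt_RD _ _ _ (gap_not_mem k _ hL)) (List.nodup_reverse.2 (srt_nodup _ _ _))
    (List.nodup_reverse.2 (srt_nodup _ _ _)) ?_ ?_ _ <;>
  · intro x; rw [List.mem_reverse, mem_srt]

lemma starW_toggle (k : ℕ) (L M : Finset (Idx k)) (c : Idx k) (h : insert c (L ∪ M) ≠ Finset.univ)
    (hc : c ∉ L ∪ M) (hc' : c - 1 ∉ L ∪ M) (w : AffS k) :
    starW k (dwordOf k (insert c L) ++ iwordOf k M) w =
      starW k (dwordOf k L ++ iwordOf k (insert c M)) w := by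
  rw [Finset.mem_union] at hc hc'
  push Not at hc hc'
  have hL : L ≠ Finset.univ := by rintro rfl; simp at hc
  have hM : M ≠ Finset.univ := by rintro rfl; simp at hc
  have hL' : insert c L ≠ Finset.univ := by
    intro hh; apply h; rw [← Finset.insert_union, hh]; simp
  have hM' : insert c M ≠ Finset.univ := by
    intro hh; apply h; rw [← Finset.union_insert, hh]; simp
  have e1 : ∀ w, starW k (dwordOf k (insert c L)) w = starW k (dwordOf k L ++ [c]) w := by
    intro w
    rw [dword_eq, dword_eq]
    refine starW_dec k (insert c L) _ _ (srt_RD _ _ _ (gap_not_mem k _ hL')) ?_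
      (List.nodup_reverse.2 (srt_nodup _ _ _)) ?_ ?_ ?_ w
    · rw [List.pairwise_append]
      refine ⟨srt_RD _ _ _ (gap_not_mem k _ hL), by simp, ?_⟩
      intro a ha b hb hab
      rw [List.mem_singleton] at hb
      rw [List.mem_reverse, mem_srt] at ha
      subst hb
      apply hc'.1
      rw [hab]; simpa using ha
    · rw [List.nodup_append]
      refine ⟨List.nodup_reverse.2 (srt_nodup _ _ _), by simp, ?_⟩
      intro a ha b hb hab
      rw [List.mem_singleton] at hb
      rw [List.mem_reverse, mem_srt] at ha
      subst hb; subst hab; exact hc.1 ha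
    · intro x; rw [List.mem_reverse, mem_srt]
    · intro x; simp [mem_srt, or_comm]
  have e2 : ∀ w, starW k (iwordOf k (insert c M)) w = starW k ([c] ++ iwordOf k M) w := by
    intro w
    rw [iword_eq, iword_eq]
    refine starW_inc k (insert c M) _ _ (srt_RI _ _ _ (gap_not_mem k _ hM')) ?_
      (srt_nodup _ _ _) ?_ (mem_srt _ _ _) ?_ w
    · rw [List.singleton_append, List.pairwise_cons]
      refine ⟨?_, srt_RI _ _ _ (gap_not_mem k _ hM)⟩
      intro a ha hab
      rw [mem_srt] at ha
      apply hc'.2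
      rw [hab]; simpa using ha
    · rw [List.singleton_append, List.nodup_cons, mem_srt]
      exact ⟨hc.2, srt_nodup _ _ _⟩
    · intro x; simp [mem_srt]
  rw [starW_append, e1, starW_append, starW_append, e2, starW_append]

/-- minimum of `S` -/
def mn (k : ℕ) (S : Finset (Idx k)) : Idx k :=
  if h : S.Nonempty then (S.exists_min_image (pos k S) h).choose else 0

lemma mn_spec (k : ℕ) (S : Finset (Idx k)) (h : S.Nonempty) :
    mn k S ∈ S ∧ ∀ y ∈ S, pos k S (mn k S) ≤ pos k S y := by
  unfold mn
  rw [dif_pos h]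
  exact (S.exists_min_image (pos k S) h).choose_spec

lemma mn_eq (k : ℕ) (S : Finset (Idx k)) (x : Idx k) (hx : x ∈ S)
    (h : ∀ y ∈ S, pos k S x ≤ pos k S y) : mn k S = x := by
  have := mn_spec k S ⟨x, hx⟩
  exact pos_inj k S (le_antisymm (this.2 x hx) (h _ this.1))

lemma pos_pred (k : ℕ) (S : Finset (Idx k)) (hS : S ≠ Finset.univ) (x : Idx k) (hx : x - 1 ∈ S) :
    pos k S x = pos k S (x - 1) + 1 := by
  have := pos_succ k S (x - 1) (by intro h; exact gap_not_mem k S hS (h ▸ hx))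
  simpa using this

lemma mn_pred (k : ℕ) (S : Finset (Idx k)) (h : S.Nonempty) (hS : S ≠ Finset.univ) :
    mn k S - 1 ∉ S := by
  intro hm
  have h1 := pos_pred k S hS _ hm
  have h2 := (mn_spec k S h).2 _ hm
  omega

/-- candidates -/
def cS (k : ℕ) (S : Finset (Idx k)) : Finset (Idx k) :=
  S.filter fun c =>
    ∃ a ∈ S, pos k S a < pos k S c ∧ a + 1 ≠ c ∧
        ∀ b ∈ S, ¬(pos k S a < pos k S b ∧ pos k S b < pos k S c)

/-- umin of the support -/
def um (k : ℕ) (S : Finset (Idx k)) : Idx k :=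
  if h : (cS k S).Nonempty then ((cS k S).exists_min_image (pos k S) h).choose else 0

lemma uminCands_eq (k : ℕ) (u : Word k) : uminCands k u = cS k (supp k u) := rfl
lemma umin_eq (k : ℕ) (u : Word k) : umin k u = um k (supp k u) := rfl

lemma um_spec (k : ℕ) (S : Finset (Idx k)) (hS : S ≠ Finset.univ) (h : (cS k S).Nonempty) :
    um k S ∈ S ∧ um k S ≠ mn k S ∧ um k S - 1 ∉ S := by
  have : um k S ∈ cS k S := by
    unfold um
    rw [dif_pos h]
    exact ((cS k S).exists_min_image (pos k S) h).choose_spec.1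
  generalize um k S = c at *
  simp only [cS, Finset.mem_filter] at this
  obtain ⟨hc, a, ha, hac, hne, hb⟩ := this
  refine ⟨hc, ?_, ?_⟩
  · rintro rfl
    have := (mn_spec k S ⟨a, ha⟩).2 a ha
    omega
  · intro hp
    have h1 := pos_pred k S hS _ hp
    have h2 := hb _ hp
    have h3 : pos k S a ≠ pos k S (c - 1) := by
      intro h; apply hne; rw [pos_inj k S h]; ring
    omega

lemma supp_Phi (k : ℕ) (L M : Finset (Idx k)) : supp k (Phi k L M) = L ∪ M := by
  ext x; simp [supp, Phi, mem_srt]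

lemma Phi_length (k : ℕ) (L M : Finset (Idx k)) : (Phi k L M).length = L.card + M.card := by
  simp [Phi, srt_length]

lemma Phi_count (k : ℕ) (L M : Finset (Idx k)) (c : Idx k) :
    (Phi k L M).count c = (if c ∈ L then 1 else 0) + (if c ∈ M then 1 else 0) := by
  simp [Phi, List.count_append, (srt_nodup k (L ∪ M) _).count, mem_srt]

/-- ascents of a list of naturals -/
def ascN (l : List ℕ) : ℕ := (l.zip l.tail).countP fun p => decide (p.1 < p.2)

lemma ascN_cons2 (a b : ℕ) (l : List ℕ) :
    ascN (a :: b :: l) = ascN (b :: l) + if a < b then 1 else 0 := by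
  simp [ascN, List.countP_cons]

lemma ascN_inc (l : List ℕ) (v : ℕ) (h : (v :: l).IsChain (· < ·)) : ascN (v :: l) = l.length := by
  induction l generalizing v with
  | nil => simp [ascN]
  | cons a l ih =>
    rw [List.isChain_cons_cons] at h
    rw [ascN_cons2, ih a h.2, if_pos h.1]; simp

lemma ascN_dec (ds t : List ℕ) (v : ℕ) (h : (ds ++ [v]).IsChain (· > ·)) :
    ascN (ds ++ v :: t) = ascN (v :: t) := by
  induction ds with
  | nil => rfl
  | cons a ds ih =>
    cases ds with
    | nil =>
      simp at h
      simp only [List.cons_append, List.nil_append, ascN_cons2]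
      rw [if_neg (by omega)]; simp
    | cons b ds =>
      simp only [List.cons_append, List.isChain_cons_cons] at h ih
      simp only [List.cons_append, ascN_cons2]
      rw [ih h.2, if_neg (by omega)]; simp

lemma srt_cons_min (k : ℕ) (S A : Finset (Idx k)) (m : Idx k) (hm : m ∈ A)
    (h : ∀ y ∈ A, pos k S m ≤ pos k S y) : srt k S A = m :: srt k S (A.erase m) := by
  have := eq_srt k S (m :: srt k S (A.erase m)) (by
    rw [List.pairwise_cons]
    refine ⟨?_, srt_pairwise _ _ _⟩
    intro y hy
    rw [mem_srt, Finset.mem_erase] at hy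
    exact lt_of_le_of_ne (h y hy.2) (fun e => hy.1 (pos_inj k S e).symm))
  rw [this]
  congr 1
  ext x; simp only [List.mem_toFinset, List.mem_cons, mem_srt, Finset.mem_erase]
  by_cases hx : x = m <;> simp [hx, hm]

lemma chain_lt_map (k : ℕ) (S : Finset (Idx k)) (l : Word k) :
    (l.map (pos k S)).IsChain (· < ·) ↔ l.Pairwise (fun a b => pos k S a < pos k S b) := by
  rw [List.isChain_iff_pairwise, List.pairwise_map]

lemma chain_gt_map (k : ℕ) (S : Finset (Idx k)) (l : Word k) :
    (l.map (pos k S)).IsChain (· > ·) ↔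
      l.reverse.Pairwise (fun a b => pos k S a < pos k S b) := by
  rw [List.isChain_iff_pairwise, List.pairwise_map, List.pairwise_reverse]

lemma Phi_V (k : ℕ) (L M : Finset (Idx k)) (hS : L ∪ M ≠ Finset.univ)
    (hL : mn k (L ∪ M) ∈ L) (hM : mn k (L ∪ M) ∉ M) :
    IsHookV k (Phi k L M) ∧ asc k (Phi k L M) = M.card := by
  set m := mn k (L ∪ M) with hm
  set S := L ∪ M with hSd
  have hmin := (mn_spec k S ⟨m, Finset.mem_union_left _ hL⟩).2
  have e1 : srt k S L = m :: srt k S (L.erase m) :=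
    srt_cons_min k S L m hL (fun y hy => hmin y (Finset.mem_union_left _ hy))
  have e2 : srt k S (insert m M) = m :: srt k S M := by
    rw [srt_cons_min k S (insert m M) m (by simp) (by
      intro y hy
      rw [Finset.mem_insert] at hy
      rcases hy with rfl | hy
      · exact le_rfl
      · exact hmin y (Finset.mem_union_right _ hy)), Finset.erase_insert hM]
  have hP : posList k (Phi k L M) = ((srt k S (L.erase m)).reverse.map (pos k S)) ++
      pos k S m :: (srt k S M).map (pos k S) := by
    rw [posList, supp_Phi, Phi, ← hSd, e1]; simp
  have c1 : ((srt k S (L.erase m)).reverse.map (pos k S) ++ [pos k S m]).IsChain (· > ·) := by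
    have : (srt k S (L.erase m)).reverse.map (pos k S) ++ [pos k S m] =
      (srt k S L).reverse.map (pos k S) := by rw [e1]; simp
    rw [this, chain_gt_map, List.reverse_reverse]
    exact srt_pairwise _ _ _
  have c2 : (pos k S m :: (srt k S M).map (pos k S)).IsChain (· < ·) := by
    rw [← List.map_cons, ← e2, chain_lt_map]; exact srt_pairwise _ _ _
  refine ⟨⟨by rw [supp_Phi]; exact hS, _, _, _, hP, c1, c2⟩, ?_⟩
  change ascN (posList k (Phi k L M)) = _
  rw [hP, ascN_dec _ _ _ c1, ascN_inc _ _ c2, List.length_map, srt_length]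

lemma Phi_U (k : ℕ) (L M : Finset (Idx k)) (hS : L ∪ M ≠ Finset.univ)
    (hL : mn k (L ∪ M) ∈ L) (hM : mn k (L ∪ M) ∈ M) :
    IsHookU k (Phi k L M) ∧ asc k (Phi k L M) + 1 = M.card := by
  set m := mn k (L ∪ M) with hm
  set S := L ∪ M with hSd
  have hmin := (mn_spec k S ⟨m, Finset.mem_union_left _ hL⟩).2
  have e1 : srt k S L = m :: srt k S (L.erase m) :=
    srt_cons_min k S L m hL (fun y hy => hmin y (Finset.mem_union_left _ hy))
  have e2 : srt k S M = m :: srt k S (M.erase m) :=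
    srt_cons_min k S M m hM (fun y hy => hmin y (Finset.mem_union_right _ hy))
  have hP : posList k (Phi k L M) = ((srt k S (L.erase m)).reverse.map (pos k S)) ++
      pos k S m :: pos k S m :: (srt k S (M.erase m)).map (pos k S) := by
    rw [posList, supp_Phi, Phi, ← hSd, e1, e2]; simp
  have c1 : ((srt k S (L.erase m)).reverse.map (pos k S) ++ [pos k S m]).IsChain (· > ·) := by
    have : (srt k S (L.erase m)).reverse.map (pos k S) ++ [pos k S m] =
      (srt k S L).reverse.map (pos k S) := by rw [e1]; simp
    rw [this, chain_gt_map, List.reverse_reverse]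
    exact srt_pairwise _ _ _
  have c2 : (pos k S m :: (srt k S (M.erase m)).map (pos k S)).IsChain (· < ·) := by
    rw [← List.map_cons, ← e2, chain_lt_map]; exact srt_pairwise _ _ _
  refine ⟨⟨by rw [supp_Phi]; exact hS, _, _, _, hP, c1, c2⟩, ?_⟩
  change ascN (posList k (Phi k L M)) + 1 = _
  rw [hP, ascN_dec _ _ _ c1, ascN_cons2, ascN_inc _ _ c2, List.length_map, srt_length,
    if_neg (lt_irrefl _), add_zero, Finset.card_erase_add_one hM]

lemma exists_pair (k : ℕ) (u l r : Word k) (x : Idx k) (hu : supp k u = (l ++ x :: r).toFinset)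
    (h1 : ((l ++ [x]).map (pos k (supp k u))).IsChain (· > ·))
    (h2 : ((x :: r).map (pos k (supp k u))).IsChain (· < ·)) :
    (u = l ++ x :: r → ∃ L M, u = Phi k L M ∧ mn k (L ∪ M) ∈ L ∧ mn k (L ∪ M) ∉ M) ∧
    (u = l ++ x :: x :: r → ∃ L M, u = Phi k L M ∧ mn k (L ∪ M) ∈ L ∧ mn k (L ∪ M) ∈ M) := by
  rw [chain_gt_map] at h1
  rw [chain_lt_map] at h2
  generalize hSd : supp k u = S at *
  have hS' : ∀ y, y ∈ S ↔ y ∈ l ∨ y = x ∨ y ∈ r := by intro y; rw [hu]; simp; tauto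
  have hx : mn k S = x := by
    refine mn_eq k S x (by simp [hS']) ?_
    intro y hy
    rw [hS'] at hy
    rcases hy with hy | rfl | hy
    · have h1' := h1
      rw [List.reverse_append, List.reverse_singleton, List.singleton_append,
        List.pairwise_cons] at h1'
      exact (h1'.1 y (by simpa using hy)).le
    · exact le_rfl
    · rw [List.pairwise_cons] at h2
      exact (h2.1 y hy).le
  have f1 := eq_srt k S _ h1
  have f2 := eq_srt k S _ h2
  have h2' := List.pairwise_cons.1 h2
  have f3 := eq_srt k S _ h2'.2
  rw [List.reverse_eq_iff] at f1
  constructor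
  · intro huu
    have hun : (l ++ [x]).reverse.toFinset ∪ r.toFinset = S := by ext y; simp [hS']; tauto
    refine ⟨(l ++ [x]).reverse.toFinset, r.toFinset, ?_, ?_, ?_⟩
    · rw [Phi, hun, ← f1, ← f3, huu]; simp
    · rw [hun, hx]; simp
    · rw [hun, hx]
      intro h
      have := h2'.1 x (by simpa using h)
      omega
  · intro huu
    have hun : (l ++ [x]).reverse.toFinset ∪ (x :: r).toFinset = S := by
      ext y; simp [hS']; tauto
    refine ⟨(l ++ [x]).reverse.toFinset, (x :: r).toFinset, ?_, ?_, ?_⟩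
    · rw [Phi, hun, ← f1, ← f2, huu]; simp
    · rw [hun, hx]; simp
    · rw [hun, hx]; simp

lemma exists_of_V (k : ℕ) (u : Word k) (h : IsHookV k u) :
    ∃ L M, u = Phi k L M ∧ mn k (L ∪ M) ∈ L ∧ mn k (L ∪ M) ∉ M := by
  obtain ⟨hS, ds, as, v, hp, c1, c2⟩ := h
  rw [posList, List.map_eq_append_iff] at hp
  obtain ⟨l, t, hu, rfl, ht⟩ := hp
  rw [List.map_eq_cons_iff] at ht
  obtain ⟨x, r, rfl, rfl, rfl⟩ := ht
  refine (exists_pair k u l r x (by rw [supp]; rw [← hu]) ?_ ?_).1 hu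
  · rw [List.map_append]; exact c1
  · exact c2

lemma exists_of_U (k : ℕ) (u : Word k) (h : IsHookU k u) :
    ∃ L M, u = Phi k L M ∧ mn k (L ∪ M) ∈ L ∧ mn k (L ∪ M) ∈ M := by
  obtain ⟨hS, ds, as, v, hp, c1, c2⟩ := h
  rw [posList, List.map_eq_append_iff] at hp
  obtain ⟨l, t, hu, rfl, ht⟩ := hp
  rw [List.map_eq_cons_iff] at ht
  obtain ⟨x, t', rfl, rfl, ht⟩ := ht
  rw [List.map_eq_cons_iff] at ht
  obtain ⟨x', r, rfl, hx, rfl⟩ := ht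
  obtain rfl := pos_inj _ _ hx
  refine (exists_pair k u l r x' (by rw [supp, hu]; ext; simp) ?_ ?_).2 hu
  · rw [List.map_append]; exact c1
  · exact c2

lemma app_inj {α : Type*} (a b c d : List α) (m : α) (h1 : m ∉ a) (h2 : m ∉ b)
    (h : a ++ m :: c = b ++ m :: d) : a = b ∧ c = d := by
  induction a generalizing b with
  | nil =>
    cases b with
    | nil => simpa using h
    | cons y b =>
      simp at h h2
      exact absurd h.1 h2.1
  | cons x a ih =>
    cases b with
    | nil =>
      simp at h h1
      exact absurd h.1.symm h1.1
    | cons y b =>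
      simp only [List.cons_append, List.cons.injEq, List.mem_cons, not_or] at *
      obtain ⟨rfl, h⟩ := h
      have := ih b h1.2 h2.2 h
      simp [this]

lemma Phi_inj (k : ℕ) (L M L' M' : Finset (Idx k)) (h : Phi k L M = Phi k L' M')
    (hL : mn k (L ∪ M) ∈ L) (hL' : mn k (L' ∪ M') ∈ L') : L = L' ∧ M = M' := by
  have hS : L ∪ M = L' ∪ M' := by rw [← supp_Phi, h, supp_Phi]
  rw [Phi, Phi, ← hS] at h
  rw [← hS] at hL'
  have hmin := (mn_spec k (L ∪ M) ⟨_, Finset.mem_union_left _ hL⟩).2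
  have hsub : L' ∪ M' ⊆ L ∪ M := hS ▸ subset_rfl
  generalize mn k (L ∪ M) = m at *
  generalize hSS : L ∪ M = S at *
  have e1 : srt k S L = m :: srt k S (L.erase m) :=
    srt_cons_min k S L m hL (fun y hy => hmin y (hSS ▸ Finset.mem_union_left _ hy))
  have e2 : srt k S L' = m :: srt k S (L'.erase m) :=
    srt_cons_min k S L' m hL' (fun y hy => hmin y (hsub (Finset.mem_union_left _ hy)))
  have hl : (srt k S (L.erase m)).reverse = (srt k S (L'.erase m)).reverse ∧
      srt k S M = srt k S M' := by
    rw [e1, e2] at h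
    simp only [List.reverse_cons, List.append_assoc, List.singleton_append] at h
    have n1 : m ∉ (srt k S (L.erase m)).reverse := by simp [mem_srt]
    have n2 : m ∉ (srt k S (L'.erase m)).reverse := by simp [mem_srt]
    exact app_inj _ _ _ _ m n1 n2 h
  constructor
  · ext y
    rw [← mem_srt k S L, ← mem_srt k S L', e1, e2, List.reverse_injective hl.1]
  · ext y
    rw [← mem_srt k S M, ← mem_srt k S M', hl.2]

lemma Phi_V_iff (k : ℕ) (L M : Finset (Idx k)) (hS : L ∪ M ≠ Finset.univ)
    (hL : mn k (L ∪ M) ∈ L) : IsHookV k (Phi k L M) ↔ mn k (L ∪ M) ∉ M := by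
  refine ⟨fun h => ?_, fun h => (Phi_V k L M hS hL h).1⟩
  obtain ⟨L', M', e, h1, h2⟩ := exists_of_V k _ h
  obtain ⟨rfl, rfl⟩ := Phi_inj k L M L' M' e hL h1
  exact h2

lemma Phi_U_iff (k : ℕ) (L M : Finset (Idx k)) (hS : L ∪ M ≠ Finset.univ)
    (hL : mn k (L ∪ M) ∈ L) : IsHookU k (Phi k L M) ↔ mn k (L ∪ M) ∈ M := by
  refine ⟨fun h => ?_, fun h => (Phi_U k L M hS hL h).1⟩
  obtain ⟨L', M', e, h1, h2⟩ := exists_of_U k _ h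
  obtain ⟨rfl, rfl⟩ := Phi_inj k L M L' M' e hL h1
  exact h2

/-- weak connectedness of pairs -/
def WC (k : ℕ) (L M : Finset (Idx k)) : Prop :=
  (cS k (L ∪ M)).Nonempty → um k (L ∪ M) ∈ L ∧ um k (L ∪ M) ∈ M

lemma Phi_WC (k : ℕ) (L M : Finset (Idx k)) (hS : L ∪ M ≠ Finset.univ) :
    IsWeakConnected k (Phi k L M) ↔ WC k L M := by
  unfold IsWeakConnected uminCount WC
  rw [uminCands_eq, umin_eq, supp_Phi, Phi_count]
  by_cases h : (cS k (L ∪ M)).Nonempty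
  · have := (um_spec k _ hS h).1
    rw [Finset.mem_union] at this
    simp only [h, if_true, true_imp_iff]
    by_cases h1 : um k (L ∪ M) ∈ L <;> by_cases h2 : um k (L ∪ M) ∈ M <;> simp_all
  · simp [h]

lemma Phi_left (k : ℕ) (L M : Finset (Idx k)) (hL : mn k (L ∪ M) ∈ L) (hM : mn k (L ∪ M) ∈ M)
    (c : Idx k) : OnLeftSide k (Phi k L M) c ↔ c ∈ L := by
  have hmin := (mn_spec k (L ∪ M) ⟨_, Finset.mem_union_left _ hL⟩).2
  constructor
  · rintro ⟨p, q, e, hc, hp⟩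
    rw [supp_Phi] at hc
    have hpw : p.reverse.Pairwise (fun a b => pos k (L ∪ M) a < pos k (L ∪ M) b) := by
      rw [← chain_gt_map]
      rw [List.isChain_map]
      exact hc
    have e1 : srt k (L ∪ M) L = mn k (L ∪ M) :: srt k (L ∪ M) (L.erase (mn k (L ∪ M))) :=
      srt_cons_min k _ L _ hL (fun y hy => hmin y (Finset.mem_union_left _ hy))
    have e2 : srt k (L ∪ M) M = mn k (L ∪ M) :: srt k (L ∪ M) (M.erase (mn k (L ∪ M))) :=
      srt_cons_min k _ M _ hM (fun y hy => hmin y (Finset.mem_union_right _ hy))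
    rw [Phi] at e
    rcases List.append_eq_append_iff.1 e with ⟨a, ha, hb⟩ | ⟨a, ha, hb⟩
    · cases a with
      | nil =>
        rw [ha] at hp; simpa [mem_srt] using hp
      | cons y a =>
        exfalso
        rw [e2, List.cons_append, List.cons.injEq] at hb
        rw [ha, e1, ← hb.1] at hpw
        have : (p.reverse).Nodup := by
          rw [ha, e1, ← hb.1]
          exact hpw.imp (fun h => by rintro rfl; exact lt_irrefl _ h)
        rw [ha, e1, ← hb.1] at this
        simp at this
        rw [List.Nodup, List.pairwise_append, List.pairwise_cons] at this
        exact this.2.1.1 _ (by simp) rfl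
    · have : c ∈ (srt k (L ∪ M) L).reverse := by rw [ha]; simp [hp]
      simpa [mem_srt] using this
  · intro hc
    refine ⟨(srt k (L ∪ M) L).reverse, srt k (L ∪ M) M, rfl, ?_, by simpa [mem_srt] using hc⟩
    rw [supp_Phi]
    have := (chain_gt_map k (L ∪ M) (srt k (L ∪ M) L).reverse).2 (by
      rw [List.reverse_reverse]; exact srt_pairwise _ _ _)
    rw [List.isChain_map] at this
    exact this

/-- pair toggle at `c` -/
def tog (k : ℕ) (c : Idx k) (p : Finset (Idx k) × Finset (Idx k)) :
    Finset (Idx k) × Finset (Idx k) :=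
  if c ∈ p.1 then (if c ∈ p.2 then p else (p.1.erase c, insert c p.2))
  else (if c ∈ p.2 then (insert c p.1, p.2.erase c) else p)

lemma tog_union (k : ℕ) (c : Idx k) (p : Finset (Idx k) × Finset (Idx k)) :
    (tog k c p).1 ∪ (tog k c p).2 = p.1 ∪ p.2 := by
  unfold tog
  ext x
  split_ifs with h1 h2 h2 <;> simp only [Finset.mem_union, Finset.mem_erase, Finset.mem_insert] <;>
    by_cases hx : x = c <;> simp_all

lemma tog_tog (k : ℕ) (c : Idx k) (p : Finset (Idx k) × Finset (Idx k)) :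
    tog k c (tog k c p) = p := by
  unfold tog
  by_cases h1 : c ∈ p.1 <;> by_cases h2 : c ∈ p.2 <;> simp [h1, h2]

/-- pairs with total size `r` -/
def Prs (k r : ℕ) : Finset (Finset (Idx k) × Finset (Idx k)) :=
  Finset.univ.filter fun p => p.1.card + p.2.card = r

lemma mem_Prs (k r : ℕ) (p) : p ∈ Prs k r ↔ p.1.card + p.2.card = r := by simp [Prs]

lemma tog_Prs (k r : ℕ) (c : Idx k) (p) (hp : p ∈ Prs k r) : tog k c p ∈ Prs k r := by
  rw [mem_Prs] at *
  unfold tog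
  split_ifs with h1 h2 h2
  · exact hp
  · have := Finset.card_erase_add_one h1
    have := Finset.card_insert_of_notMem h2
    simp only; omega
  · have := Finset.card_erase_add_one h2
    have := Finset.card_insert_of_notMem h1
    simp only; omega
  · exact hp

lemma Prs_ne_univ (k r : ℕ) (hr : r ≤ k) (p) (hp : p ∈ Prs k r) : p.1 ∪ p.2 ≠ Finset.univ := by
  rw [mem_Prs] at hp
  intro h
  have h1 := Finset.card_union_le p.1 p.2
  rw [h, Finset.card_univ, ZMod.card] at h1
  omega

lemma Prs_nonempty (k r : ℕ) (hr : 1 ≤ r) (p) (hp : p ∈ Prs k r) : (p.1 ∪ p.2).Nonempty := by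
  rw [mem_Prs] at hp
  by_contra h
  rw [Finset.not_nonempty_iff_eq_empty, Finset.union_eq_empty] at h
  rw [h.1, h.2] at hp
  simp at hp; omega

lemma starW_tog (k : ℕ) (p : Finset (Idx k) × Finset (Idx k)) (c : Idx k)
    (h : p.1 ∪ p.2 ≠ Finset.univ) (hc' : c - 1 ∉ p.1 ∪ p.2) (w : AffS k) :
    starW k (dwordOf k (tog k c p).1 ++ iwordOf k (tog k c p).2) w =
      starW k (dwordOf k p.1 ++ iwordOf k p.2) w := by
  have key : ∀ L M : Finset (Idx k), L ∪ M ≠ Finset.univ → c - 1 ∉ L ∪ M → c ∈ L → c ∉ M →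
      starW k (dwordOf k (L.erase c) ++ iwordOf k (insert c M)) w =
        starW k (dwordOf k L ++ iwordOf k M) w := by
    intro L M h hc' h1 h2
    rw [← starW_toggle k (L.erase c) M c, Finset.insert_erase h1]
    · rwa [← Finset.insert_union, Finset.insert_erase h1]
    · simp [h2]
    · intro hh; apply hc'
      simp only [Finset.mem_union, Finset.mem_erase] at hh ⊢
      tauto
  obtain ⟨L, M⟩ := p
  by_cases h1 : c ∈ L <;> by_cases h2 : c ∈ M
  · simp [tog, h1, h2]
  · simpa [tog, h1, h2] using key L M h hc' h1 h2
  · have := key (insert c L) (M.erase c) (by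
      have := tog_union k c (L, M)
      simp only [tog, h1, h2, if_true, if_false] at this
      rwa [this]) (by
      have := tog_union k c (L, M)
      simp only [tog, h1, h2, if_true, if_false] at this
      rwa [this]) (by simp) (by simp)
    rw [Finset.erase_insert h1, Finset.insert_erase h2] at this
    simpa [tog, h1, h2] using this.symm
  · simp [tog, h1, h2]

lemma tog_sum {R : Type*} [CommRing R] (k r : ℕ) (G : Finset (Idx k) × Finset (Idx k) → R)
    (w1 w2 : Finset (Idx k) × Finset (Idx k) → ℤ) (c : Finset (Idx k) → Idx k)
    (hG : ∀ p ∈ Prs k r, w1 p ≠ w2 p → G (tog k (c (p.1 ∪ p.2)) p) = G p)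
    (hw0 : ∀ p ∈ Prs k r, w1 p ≠ w2 p → tog k (c (p.1 ∪ p.2)) p ≠ p)
    (hw : ∀ p ∈ Prs k r, w1 p - w2 p +
      (w1 (tog k (c (p.1 ∪ p.2)) p) - w2 (tog k (c (p.1 ∪ p.2)) p)) = 0) :
    ∑ p ∈ Prs k r, w1 p • G p = ∑ p ∈ Prs k r, w2 p • G p := by
  rw [← sub_eq_zero, ← Finset.sum_sub_distrib]
  refine Finset.sum_involution (fun p _ => tog k (c (p.1 ∪ p.2)) p) ?_ ?_ ?_ ?_
  · intro p hp
    by_cases h : w1 p = w2 p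
    · have := hw p hp
      rw [h, sub_self, zero_add, sub_eq_zero] at this
      simp only [h, this, sub_self, add_zero]
    · rw [hG p hp h, ← sub_smul, ← sub_smul, ← add_smul, hw p hp, zero_smul]
  · intro p hp h
    apply hw0 p hp
    intro h'; apply h; rw [h', sub_self]
  · intro p hp; exact tog_Prs k r _ p hp
  · intro p hp
    simp only [tog_union, tog_tog]

/-- final weights -/
def wfin (k r : ℕ) (p : Finset (Idx k) × Finset (Idx k)) : ℤ :=
  if mn k (p.1 ∪ p.2) ∈ p.1 then
    (-1 : ℤ) ^ p.2.card *
      (if mn k (p.1 ∪ p.2) ∈ p.2 then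
        (if WC k p.1 p.2 then (r : ℤ) - p.2.card
          else if um k (p.1 ∪ p.2) ∈ p.1 then 1 else 0)
      else if WC k p.1 p.2 then 1 else 0)
  else 0

/-- middle weights -/
def wmid (k : ℕ) (p : Finset (Idx k) × Finset (Idx k)) : ℤ :=
  if mn k (p.1 ∪ p.2) ∈ p.1 then
    (-1 : ℤ) ^ p.2.card * (if mn k (p.1 ∪ p.2) ∈ p.2 then (p.1.card : ℤ) else 1)
  else 0

lemma step1 {R : Type*} [CommRing R] (k r : ℕ) (hr1 : 1 ≤ r) (hr : r ≤ k) (f : AffS k → R)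
    (w : AffS k) :
    ∑ p ∈ Prs k r, ((-1 : ℤ) ^ p.2.card * p.1.card) •
        f (starW k (dwordOf k p.1 ++ iwordOf k p.2) w) =
    ∑ p ∈ Prs k r, (wmid k p) • f (starW k (dwordOf k p.1 ++ iwordOf k p.2) w) := by
  refine tog_sum k r _ _ _ (mn k) ?_ ?_ ?_
  · intro p hp _
    rw [starW_tog]
    · exact Prs_ne_univ k r hr p hp
    · exact mn_pred k _ (Prs_nonempty k r hr1 p hp) (Prs_ne_univ k r hr p hp)
  · intro p hp hne h
    have hm := (mn_spec k _ (Prs_nonempty k r hr1 p hp)).1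
    unfold wmid at hne
    generalize mn k (p.1 ∪ p.2) = m at *
    rw [Finset.mem_union] at hm
    by_cases h1 : m ∈ p.1 <;> by_cases h2 : m ∈ p.2
    · simp [h1, h2] at hne
    · simp only [tog, h1, h2, if_true, if_false] at h
      rw [← h] at h1; simp at h1
    · simp only [tog, h1, h2, if_true, if_false] at h
      rw [← h] at h1; simp at h1
    · tauto
  · intro p hp
    have hm := (mn_spec k _ (Prs_nonempty k r hr1 p hp)).1
    unfold wmid
    rw [tog_union]
    generalize mn k (p.1 ∪ p.2) = m at *
    rw [Finset.mem_union] at hm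
    by_cases h1 : m ∈ p.1 <;> by_cases h2 : m ∈ p.2
    · simp [tog, h1, h2]
    · have e1 := Finset.card_erase_add_one h1
      have e2 := Finset.card_insert_of_notMem h2
      simp only [tog, h1, h2, if_true, if_false, Finset.mem_erase, ne_eq, not_true, false_and, e2]
      rw [← e1]; push_cast; ring
    · have e1 := Finset.card_erase_add_one h2
      have e2 := Finset.card_insert_of_notMem h1
      simp only [tog, h1, h2, if_true, if_false, Finset.mem_erase, ne_eq, not_true, false_and, e2,
        Finset.mem_insert, true_or]
      rw [← e1]; push_cast; ring
    · tauto

lemma step2 {R : Type*} [CommRing R] (k r : ℕ) (hr : r ≤ k) (f : AffS k → R)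
    (w : AffS k) :
    ∑ p ∈ Prs k r, (wmid k p) • f (starW k (dwordOf k p.1 ++ iwordOf k p.2) w) =
    ∑ p ∈ Prs k r, (wfin k r p) • f (starW k (dwordOf k p.1 ++ iwordOf k p.2) w) := by
  have hcard : ∀ p ∈ Prs k r, (r : ℤ) = p.1.card + p.2.card := by
    intro p hp; rw [mem_Prs] at hp; exact_mod_cast hp.symm
  have hWC : ∀ p ∈ Prs k r, WC k p.1 p.2 → wmid k p = wfin k r p := by
    intro p hp h
    simp [wmid, wfin, h, hcard p hp]
  have hn : ∀ p ∈ Prs k r, ¬ WC k p.1 p.2 → (cS k (p.1 ∪ p.2)).Nonempty ∧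
      ¬ (um k (p.1 ∪ p.2) ∈ p.1 ∧ um k (p.1 ∪ p.2) ∈ p.2) := by
    intro p hp h
    unfold WC at h
    tauto
  refine tog_sum k r _ _ _ (um k) ?_ ?_ ?_
  · intro p hp hne
    have h := hn p hp (fun h => hne (hWC p hp h))
    rw [starW_tog]
    · exact Prs_ne_univ k r hr p hp
    · exact (um_spec k _ (Prs_ne_univ k r hr p hp) h.1).2.2
  · intro p hp hne h
    have hh := hn p hp (fun h => hne (hWC p hp h))
    have hm := (um_spec k _ (Prs_ne_univ k r hr p hp) hh.1).1
    generalize um k (p.1 ∪ p.2) = m at *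
    rw [Finset.mem_union] at hm
    by_cases h1 : m ∈ p.1 <;> by_cases h2 : m ∈ p.2
    · tauto
    · simp only [tog, h1, h2, if_true, if_false] at h
      rw [← h] at h1; simp at h1
    · simp only [tog, h1, h2, if_true, if_false] at h
      rw [← h] at h1; simp at h1
    · tauto
  · intro p hp
    by_cases hW : WC k p.1 p.2
    · have hW' : WC k (tog k (um k (p.1 ∪ p.2)) p).1 (tog k (um k (p.1 ∪ p.2)) p).2 := by
        by_cases hc : (cS k (p.1 ∪ p.2)).Nonempty
        · have h := hW hc
          simpa [tog, h.1, h.2] using hW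
        · intro h
          rw [tog_union] at h
          exact absurd h hc
      rw [hWC p hp hW, hWC _ (tog_Prs k r _ p hp) hW']; simp
    · have hh := hn p hp hW
      obtain ⟨hm, hmn, -⟩ := um_spec k _ (Prs_ne_univ k r hr p hp) hh.1
      have hW' : ¬ WC k (tog k (um k (p.1 ∪ p.2)) p).1 (tog k (um k (p.1 ∪ p.2)) p).2 := by
        intro h
        unfold WC at h
        rw [tog_union] at h
        have h := h hh.1
        have hh2 := hh.2
        generalize um k (p.1 ∪ p.2) = m at *
        by_cases h1 : m ∈ p.1 <;> by_cases h2 : m ∈ p.2 <;> simp [tog, h1, h2] at h hh2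
      unfold wmid wfin
      rw [if_neg hW, if_neg hW, if_neg hW', if_neg hW', tog_union]
      have hmn' := hmn.symm
      have hh2 := hh.2
      clear hW hW' hh hWC hn
      generalize um k (p.1 ∪ p.2) = c at *
      generalize mn k (p.1 ∪ p.2) = m at *
      rw [Finset.mem_union] at hm
      by_cases h1 : c ∈ p.1 <;> by_cases h2 : c ∈ p.2
      · tauto
      · have e1 := Finset.card_erase_add_one h1
        have e2 := Finset.card_insert_of_notMem h2
        simp only [tog, h1, h2, if_true, if_false, Finset.mem_erase, ne_eq, not_true, false_and, e2,
          Finset.mem_insert, hmn', not_false_eq_true, true_and, false_or]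
        rw [← e1]
        split_ifs <;> push_cast <;> ring
      · have e1 := Finset.card_erase_add_one h2
        have e2 := Finset.card_insert_of_notMem h1
        simp only [tog, h1, h2, if_true, if_false, Finset.mem_erase, ne_eq, not_true, false_and, e2,
          Finset.mem_insert, hmn', not_false_eq_true, true_and, false_or, true_or]
        rw [← e1]
        split_ifs <;> push_cast <;> ring
      · tauto

/-- the word weight -/
def cw (k r : ℕ) (u : Word k) : ℤ :=
  (∑ i ∈ Finset.range r, (-1 : ℤ) ^ i * (if u ∈ VSetWC k r (i : ℤ) then 1 else 0)) +
    (∑ i ∈ Finset.Icc 1 (r - 1),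
      (-1 : ℤ) ^ i * ((r : ℤ) - i) * (if u ∈ USetWC k r ((i : ℤ) - 1) then 1 else 0)) +
    ∑ i ∈ Finset.Icc 1 (r - 2),
      (-1 : ℤ) ^ i * (if u ∈ USetNWCL k r ((i : ℤ) - 1) then 1 else 0)

lemma cw_Phi (k r : ℕ) (hr : r ≤ k) (p) (hp : p ∈ Prs k r)
    (hL : mn k (p.1 ∪ p.2) ∈ p.1) : cw k r (Phi k p.1 p.2) = wfin k r p := by
  have hS := Prs_ne_univ k r hr p hp
  have hc := (mem_Prs k r p).1 hp
  have hl : (Phi k p.1 p.2).length = r := by rw [Phi_length, hc]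
  have hLc : 1 ≤ p.1.card := Finset.card_pos.2 ⟨_, hL⟩
  unfold cw wfin
  simp only [VSetWC, USetWC, USetNWCL, VSet, USet, Set.mem_setOf_eq, Phi_WC k _ _ hS,
    Phi_V_iff k _ _ hS hL, Phi_U_iff k _ _ hS hL, hl, true_and, hL, if_true]
  by_cases hM : mn k (p.1 ∪ p.2) ∈ p.2
  · have ha := (Phi_U k _ _ hS hL hM).2
    have hac : ∀ i : ℕ, ((asc k (Phi k p.1 p.2) : ℤ) = (i : ℤ) - 1) ↔ p.2.card = i := by
      intro i; omega
    have hMc : 1 ≤ p.2.card := Finset.card_pos.2 ⟨_, hM⟩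
    simp only [hM, not_true, false_and, if_false, mul_zero, Finset.sum_const_zero, zero_add,
      true_and, if_true, hac, umin_eq, supp_Phi, Phi_left k _ _ hL hM]
    by_cases hW : WC k p.1 p.2
    · simp only [hW, and_true, not_true, false_and, and_false, if_false, mul_zero,
        Finset.sum_const_zero, add_zero, if_true, mul_ite, mul_one]
      rw [Finset.sum_ite_eq, if_pos (by rw [Finset.mem_Icc]; omega)]
    · simp only [hW, and_false, if_false, mul_zero, Finset.sum_const_zero, zero_add,
        not_false_eq_true, true_and]
      by_cases hu : um k (p.1 ∪ p.2) ∈ p.1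
      · have hcn : (cS k (p.1 ∪ p.2)).Nonempty := by
          by_contra h; exact hW (fun h' => absurd h' h)
        have hne := (um_spec k _ hS hcn).2.1
        have h2 : 2 ≤ p.1.card := Finset.one_lt_card.2 ⟨_, hu, _, hL, hne⟩
        simp only [hu, and_true, mul_ite, mul_one, mul_zero, if_true]
        rw [Finset.sum_ite_eq, if_pos (by rw [Finset.mem_Icc]; omega)]
      · simp [hu]
  · have ha := (Phi_V k _ _ hS hL hM).2
    simp only [hM, not_false_eq_true, false_and, if_false, mul_zero, Finset.sum_const_zero,
      add_zero, true_and, ha, Nat.cast_inj]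
    by_cases hW : WC k p.1 p.2
    · simp only [hW, and_true, if_true, mul_ite, mul_one, mul_zero]
      rw [Finset.sum_ite_eq, if_pos (by rw [Finset.mem_range]; omega)]
    · simp [hW]

lemma words_finite (k r : ℕ) : {u : Word k | u.length = r}.Finite := List.finite_length_eq _ r

/-- words of length r -/
def Om (k r : ℕ) : Finset (Word k) := (words_finite k r).toFinset

lemma mem_Om (k r : ℕ) (u : Word k) : u ∈ Om k r ↔ u.length = r := by simp [Om]

lemma cw_zero (k r : ℕ) (u : Word k) (h : cw k r u ≠ 0) : IsHookV k u ∨ IsHookU k u := by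
  by_contra hc
  push Not at hc
  apply h
  simp [cw, VSetWC, USetWC, USetNWCL, VSet, USet, hc.1, hc.2]

lemma sum_words {R : Type*} [CommRing R] (k r : ℕ) (hr : r ≤ k) (f : AffS k → R)
    (w : AffS k) :
    ∑ p ∈ Prs k r, (wfin k r p) • f (starW k (dwordOf k p.1 ++ iwordOf k p.2) w) =
    ∑ u ∈ Om k r, cw k r u • f (starW k u w) := by
  have e0 : ∑ p ∈ Prs k r, (wfin k r p) • f (starW k (dwordOf k p.1 ++ iwordOf k p.2) w) =
      ∑ p ∈ (Prs k r).filter (fun p => mn k (p.1 ∪ p.2) ∈ p.1),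
        cw k r (Phi k p.1 p.2) • f (starW k (Phi k p.1 p.2) w) := by
    rw [Finset.sum_filter]
    refine Finset.sum_congr rfl fun p hp => ?_
    split_ifs with h
    · rw [cw_Phi k r hr p hp h, starW_Phi k _ _ (Prs_ne_univ k r hr p hp)]
    · simp [wfin, h]
  rw [e0]
  refine Finset.sum_bij_ne_zero (fun p _ _ => Phi k p.1 p.2) ?_ ?_ ?_ ?_
  · intro p hp _
    rw [Finset.mem_filter, mem_Prs] at hp
    rw [mem_Om, Phi_length, hp.1]
  · intro p hp _ q hq _ h
    rw [Finset.mem_filter] at hp hq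
    have := Phi_inj k _ _ _ _ h hp.2 hq.2
    exact Prod.ext this.1 this.2
  · intro u hu h
    have : ∃ L M, u = Phi k L M ∧ mn k (L ∪ M) ∈ L := by
      have hc : cw k r u ≠ 0 := by intro h0; rw [h0, zero_smul] at h; exact h rfl
      rcases cw_zero k r u hc with h | h
      · obtain ⟨L, M, h1, h2, -⟩ := exists_of_V k u h
        exact ⟨L, M, h1, h2⟩
      · obtain ⟨L, M, h1, h2, -⟩ := exists_of_U k u h
        exact ⟨L, M, h1, h2⟩
    obtain ⟨L, M, rfl, hL⟩ := this
    rw [mem_Om, Phi_length] at hu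
    exact ⟨(L, M), by rw [Finset.mem_filter, mem_Prs]; exact ⟨hu, hL⟩, h, rfl⟩
  · intros; rfl

lemma ncard_eq (k r : ℕ) (X : Set (Word k)) (hX : ∀ u ∈ X, u.length = r) (P : Word k → Prop) :
    ({u ∈ X | P u}.ncard : ℤ) = ∑ u ∈ Om k r, (if u ∈ X then 1 else 0) * (if P u then 1 else 0) := by
  have : {u ∈ X | P u} = ((Om k r).filter (fun u => u ∈ X ∧ P u) : Finset (Word k)) := by
    ext u
    simp only [Set.mem_setOf_eq, Finset.coe_filter, mem_Om]
    exact ⟨fun h => ⟨hX u h.1, h⟩, fun h => h.2⟩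
  rw [this, Set.ncard_coe_finset, Finset.card_filter]
  push_cast
  refine Finset.sum_congr rfl fun u _ => ?_
  by_cases h1 : u ∈ X <;> by_cases h2 : P u <;> simp [h1, h2]

lemma MNcoeff_eq (k r : ℕ) (P : Word k → Prop) :
    MNcoeff k r P = ∑ u ∈ Om k r, cw k r u * (if P u then 1 else 0) := by
  unfold MNcoeff cw
  simp only [add_mul, Finset.sum_add_distrib, Finset.sum_mul]
  congr 1
  · congr 1
    · rw [Finset.sum_comm]
      refine Finset.sum_congr rfl fun i _ => ?_
      rw [ncard_eq k r _ (fun u hu => hu.1.2.1), Finset.mul_sum]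
      exact Finset.sum_congr rfl fun u _ => by ring
    · rw [Finset.sum_comm]
      refine Finset.sum_congr rfl fun i _ => ?_
      rw [ncard_eq k r _ (fun u hu => hu.1.2.1), Finset.mul_sum]
      exact Finset.sum_congr rfl fun u _ => by ring
  · rw [Finset.sum_comm]
    refine Finset.sum_congr rfl fun i _ => ?_
    rw [ncard_eq k r _ (fun u hu => hu.1.2.1), Finset.mul_sum]
    exact Finset.sum_congr rfl fun u _ => by ring

lemma sum_fold {R : Type*} [CommRing R] (r : ℕ) (a : ℕ → R) :
    ∑ i ∈ Finset.range r, ∑ j ∈ Finset.range (i + 1), a j =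
      ∑ b ∈ Finset.range (r + 1), ((r : ℤ) - b) • a b := by
  induction r with
  | zero => simp
  | succ n ih =>
    rw [Finset.sum_range_succ, ih, Finset.sum_range_succ _ (n + 1)]
    simp only [Nat.cast_succ, sub_self, zero_smul, add_zero]
    rw [← Finset.sum_add_distrib]
    refine Finset.sum_congr rfl fun b _ => ?_
    rw [add_sub_right_comm, add_smul, one_smul]

lemma pairs_sum {R : Type*} [CommRing R] (k r : ℕ)
    (G : Finset (Idx k) → Finset (Idx k) → R) :
    ∑ b ∈ Finset.range (r + 1), ((r : ℤ) - b) • ((-1 : ℤ) ^ b •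
      ∑ B ∈ Finset.powersetCard b (Finset.univ : Finset (Idx k)),
        ∑ A ∈ Finset.powersetCard (r - b) (Finset.univ : Finset (Idx k)), G A B) =
    ∑ p ∈ Prs k r, ((-1 : ℤ) ^ p.2.card * p.1.card) • G p.1 p.2 := by
  rw [← Finset.sum_fiberwise_of_maps_to (s := Prs k r) (t := Finset.range (r + 1))
    (g := fun p => p.2.card)]
  · refine Finset.sum_congr rfl fun b hb => ?_
    rw [Finset.mem_range] at hb
    rw [Finset.sum_comm, ← Finset.sum_product', Finset.smul_sum, Finset.smul_sum]
    refine Finset.sum_congr ?_ ?_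
    · ext p
      simp only [Finset.mem_product, Finset.mem_powersetCard, Finset.subset_univ, true_and,
        Finset.mem_filter, mem_Prs]
      omega
    · intro p hp
      simp only [Finset.mem_filter, mem_Prs] at hp
      rw [smul_smul, hp.2]
      congr 1
      have : (p.1.card : ℤ) = r - b := by omega
      rw [this]; ring
  · intro p hp
    rw [mem_Prs] at hp
    rw [Finset.mem_range]; omega

lemma msign_mul (R : Type*) [Ring R] (a b : ℤ) : msign R a * msign R b = msign R (a + b) := by
  unfold msign
  rw [← Units.val_mul, ← zpow_add]

theorem statement9 (k : ℕ) (hk : 1 ≤ k)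
    (R : Type*) [CommRing R]
    (hR eR : ℕ → R) (hR0 : hR 0 = 1) (eR0 : eR 0 = 1)
    (g : AffS k → R) (hg1 : g 1 = 1)
    (hPieriH : ∀ w : AffS k, IsGrassmannian k w → ∀ r : ℕ, r ≤ k →
      hR r * g w =
        ∑ A ∈ (Finset.powersetCard r (Finset.univ : Finset (Idx k))).filter
            (fun A => IsGrassmannian k (starW k (dwordOf k A) w)),
          msign R ((r : ℤ) - len k (starW k (dwordOf k A) w) + len k w) *
            g (starW k (dwordOf k A) w))
    (hPieriE : ∀ w : AffS k, IsGrassmannian k w → ∀ r : ℕ, r ≤ k →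
      eR r * g w =
        ∑ B ∈ (Finset.powersetCard r (Finset.univ : Finset (Idx k))).filter
            (fun B => IsGrassmannian k (starW k (iwordOf k B) w)),
          msign R ((r : ℤ) - len k (starW k (iwordOf k B) w) + len k w) *
            g (starW k (iwordOf k B) w))
    (r : ℕ) (hr1 : 1 ≤ r) (hrk : r ≤ k) (w : AffS k) (hw : IsGrassmannian k w) :
    pR hR eR r * g w =
      ∑ᶠ w' ∈ {w' : AffS k | IsGrassmannian k w'},
        msign R ((r : ℤ) - len k w' + len k w) *
          (MNcoeff k r (fun u => starW k u w = w') • g w') := by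
  set f : AffS k → R := fun x => if IsGrassmannian k x then
    msign R ((r : ℤ) - len k x + len k w) * g x else 0 with hf
  have hE : ∀ b ≤ r, hR (r - b) * eR b * g w =
      ∑ B ∈ Finset.powersetCard b (Finset.univ : Finset (Idx k)),
        ∑ A ∈ Finset.powersetCard (r - b) (Finset.univ : Finset (Idx k)),
          f (starW k (dwordOf k A ++ iwordOf k B) w) := by
    intro b hb
    rw [mul_assoc, hPieriE w hw b (by omega), Finset.mul_sum, Finset.sum_filter]
    refine Finset.sum_congr rfl fun B _ => ?_
    split_ifs with hB
    · rw [mul_left_comm, hPieriH _ hB (r - b) (by omega), Finset.mul_sum, Finset.sum_filter]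
      refine Finset.sum_congr rfl fun A _ => ?_
      simp only [hf, starW_append]
      split_ifs with hA
      · rw [← mul_assoc, msign_mul]
        congr 2
        push_cast [Nat.cast_sub hb]
        ring
      · rfl
    · symm
      refine Finset.sum_eq_zero fun A _ => ?_
      simp only [hf, starW_append]
      rw [if_neg]
      intro h
      exact hB (grass_of_starW k _ _ h)
  have hL : pR hR eR r * g w =
      ∑ p ∈ Prs k r, ((-1 : ℤ) ^ p.2.card * p.1.card) •
        f (starW k (dwordOf k p.1 ++ iwordOf k p.2) w) := by
    rw [← pairs_sum k r (fun A B => f (starW k (dwordOf k A ++ iwordOf k B) w))]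
    have e1 : pR hR eR r * g w = ∑ i ∈ Finset.range r, ∑ b ∈ Finset.range (i + 1),
        ((-1 : ℤ) ^ b • (hR (r - b) * eR b * g w)) := by
      unfold pR
      rw [Finset.sum_mul]
      refine Finset.sum_congr rfl fun i hi => ?_
      rw [Finset.mem_range] at hi
      rw [Finset.sum_mul, ← Finset.sum_range_reflect]
      refine Finset.sum_congr rfl fun j hj => ?_
      rw [Finset.mem_range] at hj
      have h1 : i - (i + 1 - 1 - j) = j := by omega
      have h2 : r - i + (i + 1 - 1 - j) = r - j := by omega
      have h3 : (-1 : ℤ) ^ (i + (i + 1 - 1 - j)) = (-1) ^ j := by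
        have : i + (i + 1 - 1 - j) + 2 * j = 2 * i + j := by omega
        calc (-1 : ℤ) ^ (i + (i + 1 - 1 - j)) = (-1 : ℤ) ^ (i + (i + 1 - 1 - j) + 2 * j) := by
              rw [pow_add _ _ (2 * j)]; simp
          _ = _ := by rw [this, pow_add]; simp
      rw [h1, h2, h3, smul_mul_assoc]
    rw [e1, sum_fold]
    refine Finset.sum_congr rfl fun b hb => ?_
    rw [Finset.mem_range] at hb
    rw [hE b (by omega)]
  rw [hL, step1 k r hr1 hrk f w, step2 k r hrk f w, sum_words k r hrk f w]
  have hRt : ∀ w', (∑ᶠ (_ : w' ∈ {w' : AffS k | IsGrassmannian k w'}),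
        msign R ((r : ℤ) - len k w' + len k w) *
          (MNcoeff k r (fun u => starW k u w = w') • g w')) =
      ∑ u ∈ Om k r, if starW k u w = w' then cw k r u • f w' else 0 := by
    intro w'
    have : ∑ u ∈ Om k r, (if starW k u w = w' then cw k r u • f w' else 0) =
        MNcoeff k r (fun u => starW k u w = w') • f w' := by
      rw [MNcoeff_eq, Finset.sum_smul]
      refine Finset.sum_congr rfl fun u _ => ?_
      split_ifs <;> simp
    rw [this]
    by_cases h : IsGrassmannian k w'
    · rw [finsum_eq_if, if_pos (by exact h)]
      simp only [hf, if_pos h]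
      rw [mul_smul_comm]
    · rw [finsum_eq_if, if_neg (by exact h)]
      simp only [hf, if_neg h, smul_zero]
  rw [finsum_congr hRt]
  rw [finsum_eq_sum_of_support_subset (s := (Om k r).image (fun u => starW k u w))]
  · rw [Finset.sum_comm]
    refine Finset.sum_congr rfl fun u hu => ?_
    rw [Finset.sum_ite_eq, if_pos (Finset.mem_image_of_mem _ hu)]
  · intro x hx
    rw [Function.mem_support] at hx
    obtain ⟨u, hu, h⟩ := Finset.exists_ne_zero_of_sum_ne_zero hx
    rw [Finset.coe_image]
    refine ⟨u, hu, ?_⟩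
    by_contra hne
    exact h (if_neg hne)

end MN

end
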